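/- arXiv:1602.02436 — 13 statements merged into one kernel-verified Lean document; each statement's English description precedes it below -/
import Mathlib

section
/- (Duality.) Let G be a finite subgroup of GL(n, ℂ), n ≥ 1. Then in K one has (−y)^n · |G|⁻¹ · Σ_{g ∈ G} det(1 + (y·T)⁻¹·g) / det(1 − T⁻¹·g) = H_G, i.e. the paper's identity H(1/y, 1/T)·(−y)^n = H(y,T). -/
open scoped BigOperators

/-- The fraction field `K` of the polynomial ring `ℂ[y, T]` in two variables. -/
noncomputable abbrev MolienK : Type := FractionRing (MvPolynomial (Fin 2) ℂ)

/-- The variable `y ∈ K`. -/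
noncomputable abbrev molienY : MolienK :=
  algebraMap (MvPolynomial (Fin 2) ℂ) MolienK (MvPolynomial.X 0)

/-- The variable `T ∈ K`. -/
noncomputable abbrev molienT : MolienK :=
  algebraMap (MvPolynomial (Fin 2) ℂ) MolienK (MvPolynomial.X 1)

/-- A complex `n × n` matrix regarded as a matrix over `K` via `ℂ ↪ K`. -/
noncomputable abbrev matK {n : ℕ} (g : Matrix (Fin n) (Fin n) ℂ) :
    Matrix (Fin n) (Fin n) MolienK :=
  g.map (algebraMap ℂ MolienK)

/-- `H_G := |G|⁻¹ · ∑_{g ∈ G} det(1 + y·T·g) / det(1 − T·g) ∈ K`, the local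
equivariant Hirzebruch class (= extended Molien series `Mol(yT, T)`) of `ℂⁿ/G`. -/
noncomputable def HclassGL (n : ℕ) (G : Subgroup (Matrix.GeneralLinearGroup (Fin n) ℂ))
    [Fintype G] : MolienK :=
  (Fintype.card G : MolienK)⁻¹ *
    ∑ g : G, Matrix.det (1 + (molienY * molienT) • matK
        ((g : Matrix.GeneralLinearGroup (Fin n) ℂ) : Matrix (Fin n) (Fin n) ℂ)) /
      Matrix.det (1 - molienT • matK
        ((g : Matrix.GeneralLinearGroup (Fin n) ℂ) : Matrix (Fin n) (Fin n) ℂ))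

theorem Matrix.det_one_add_inv_smul {F ι : Type*} [Field F] [Fintype ι] [DecidableEq ι]
    {A B : Matrix ι ι F} (hAB : A * B = 1) {s : F} (hs : s ≠ 0) :
    (1 + s⁻¹ • A).det = s⁻¹ ^ Fintype.card ι * (A.det * (1 + s • B).det) := by
  rw [← Matrix.det_mul, ← Matrix.det_smul, mul_add, mul_one, Matrix.mul_smul, hAB, smul_add,
    smul_smul, inv_mul_cancel₀ hs, one_smul, add_comm]

theorem Matrix.neg_pow_mul_det_div_det {F ι : Type*} [Field F] [Fintype ι] [DecidableEq ι]
    {A B : Matrix ι ι F} (hAB : A * B = 1) {y t : F} (hy : y ≠ 0) (ht : t ≠ 0) :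
    (-y) ^ Fintype.card ι * ((1 + (y * t)⁻¹ • A).det / (1 - t⁻¹ • A).det) =
      (1 + (y * t) • B).det / (1 - t • B).det := by
  have hA : A.det ≠ 0 := left_ne_zero_of_mul_eq_one (b := B.det) (by
    rw [← Matrix.det_mul, hAB, Matrix.det_one])
  have hden := Matrix.det_one_add_inv_smul hAB (neg_ne_zero.mpr ht)
  rw [inv_neg, neg_smul, neg_smul, ← sub_eq_add_neg, ← sub_eq_add_neg] at hden
  have hpow : (-y) ^ Fintype.card ι * (y * t)⁻¹ ^ Fintype.card ι = (-t⁻¹) ^ Fintype.card ι := by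
    rw [← mul_pow]
    congr 1
    field_simp
  rw [Matrix.det_one_add_inv_smul hAB (mul_ne_zero hy ht), hden, ← mul_div_assoc, ← mul_assoc,
    hpow, mul_div_mul_left _ _ (pow_ne_zero _ (neg_ne_zero.mpr (inv_ne_zero ht))),
    mul_div_mul_left _ _ hA]

theorem matK_mul_matK_inv {n : ℕ} (g : Matrix.GeneralLinearGroup (Fin n) ℂ) :
    matK (g : Matrix (Fin n) (Fin n) ℂ) *
      matK ((g⁻¹ : Matrix.GeneralLinearGroup (Fin n) ℂ) : Matrix (Fin n) (Fin n) ℂ) = 1 := by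
  rw [← Matrix.map_mul, ← Units.val_mul, mul_inv_cancel, Units.val_one,
    Matrix.map_one _ (map_zero _) (map_one _)]

theorem algebraMap_X_ne_zero (i : Fin 2) :
    algebraMap (MvPolynomial (Fin 2) ℂ) MolienK (MvPolynomial.X i) ≠ 0 :=
  (map_ne_zero_iff _ (IsFractionRing.injective _ _)).mpr (MvPolynomial.X_ne_zero i)

/-- **Duality.** For a finite subgroup `G ⊆ GL(n, ℂ)`, `n ≥ 1`, one has
`H(1/y, 1/T)·(−y)^n = H(y, T)` in `K = ℂ(y, T)`. -/
theorem duality_hirzebruch_molien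
    (n : ℕ) (hn : 1 ≤ n)
    (G : Subgroup (Matrix.GeneralLinearGroup (Fin n) ℂ)) [Fintype G] :
    (-molienY) ^ n * ((Fintype.card G : MolienK)⁻¹ *
      ∑ g : G, Matrix.det (1 + (molienY * molienT)⁻¹ • matK
          ((g : Matrix.GeneralLinearGroup (Fin n) ℂ) : Matrix (Fin n) (Fin n) ℂ)) /
        Matrix.det (1 - molienT⁻¹ • matK
          ((g : Matrix.GeneralLinearGroup (Fin n) ℂ) : Matrix (Fin n) (Fin n) ℂ)))
      = HclassGL n G := by
  rw [HclassGL, mul_left_comm, Finset.mul_sum]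
  congr 1
  refine Fintype.sum_equiv (Equiv.inv G) _ _ fun g => ?_
  have h := Matrix.neg_pow_mul_det_div_det
    (matK_mul_matK_inv (g : Matrix.GeneralLinearGroup (Fin n) ℂ))
    (algebraMap_X_ne_zero 0) (algebraMap_X_ne_zero 1)
  rwa [Fintype.card_fin] at h
end

section
/- (Divisibility.) Let G be a finite subgroup of GL(n, ℂ), n ≥ 1. Then the polynomial y + 1 divides P_G − 1 in the polynomial ring F[y]. -/
open scoped BigOperators Polynomial

set_option synthInstance.maxHeartbeats 1000000

/-- A complex `n × n` matrix regarded over `F = ℂ(T)` (`RatFunc ℂ`). -/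
noncomputable abbrev matRatFunc {n : ℕ} (g : Matrix (Fin n) (Fin n) ℂ) :
    Matrix (Fin n) (Fin n) (RatFunc ℂ) :=
  g.map (algebraMap ℂ (RatFunc ℂ))

/-- A complex `n × n` matrix regarded over the polynomial ring `F[y]`,
`F = ℂ(T)`. -/
noncomputable abbrev matRatFuncPoly {n : ℕ} (g : Matrix (Fin n) (Fin n) ℂ) :
    Matrix (Fin n) (Fin n) (Polynomial (RatFunc ℂ)) :=
  g.map (fun c => Polynomial.C (algebraMap ℂ (RatFunc ℂ) c))

/-- `P_G := |G|⁻¹ · ∑_{g ∈ G} (det(1 − T·g))⁻¹ · det(1 + T·y·g) ∈ F[y]`, the paper's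
Hirzebruch class `H(y, T)` of `ℂⁿ/G` viewed as a polynomial in `y` over `F = ℂ(T)`. -/
noncomputable def PclassGL (n : ℕ) (G : Subgroup (Matrix.GeneralLinearGroup (Fin n) ℂ))
    [Fintype G] : Polynomial (RatFunc ℂ) :=
  Polynomial.C (Fintype.card G : RatFunc ℂ)⁻¹ *
    ∑ g : G,
      Polynomial.C (Matrix.det ((1 : Matrix (Fin n) (Fin n) (RatFunc ℂ)) -
          (RatFunc.X : RatFunc ℂ) • matRatFunc
          ((g : Matrix.GeneralLinearGroup (Fin n) ℂ) : Matrix (Fin n) (Fin n) ℂ)))⁻¹ *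
      Matrix.det (1 + (Polynomial.C (RatFunc.X : RatFunc ℂ) * Polynomial.X) • matRatFuncPoly
          ((g : Matrix.GeneralLinearGroup (Fin n) ℂ) : Matrix (Fin n) (Fin n) ℂ))

/-- The determinant `det(1 − T·g)` is the image in `ℂ(T)` of the reversed characteristic
polynomial of `g`. -/
theorem det_one_sub_X_smul_matRatFunc {n : ℕ} (g : Matrix (Fin n) (Fin n) ℂ) :
    (1 - (RatFunc.X : RatFunc ℂ) • matRatFunc g).det =
      algebraMap ℂ[X] (RatFunc ℂ) g.charpolyRev := by
  rw [Matrix.charpolyRev, RingHom.map_det]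
  congr 1
  ext i j
  by_cases h : i = j <;>
    simpa [matRatFunc, h, RatFunc.algebraMap_eq_C] using mul_comm _ _

theorem det_one_sub_X_smul_matRatFunc_ne_zero {n : ℕ} (g : Matrix (Fin n) (Fin n) ℂ) :
    (1 - (RatFunc.X : RatFunc ℂ) • matRatFunc g).det ≠ 0 := by
  rw [det_one_sub_X_smul_matRatFunc]
  refine RatFunc.algebraMap_ne_zero fun h => ?_
  have h_eval := Matrix.eval_charpolyRev (M := g)
  simp [h] at h_eval

theorem eval_neg_one_det_matRatFuncPoly {n : ℕ} (g : Matrix (Fin n) (Fin n) ℂ) :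
    (Matrix.det (1 + (Polynomial.C (RatFunc.X : RatFunc ℂ) * Polynomial.X) •
      matRatFuncPoly g)).eval (-1) = (1 - (RatFunc.X : RatFunc ℂ) • matRatFunc g).det := by
  rw [← Polynomial.coe_evalRingHom, RingHom.map_det]
  congr 1
  ext i j
  by_cases h : i = j <;>
    simp [matRatFunc, matRatFuncPoly, h, sub_eq_add_neg]

theorem eval_neg_one_PclassGL (n : ℕ) (G : Subgroup (Matrix.GeneralLinearGroup (Fin n) ℂ))
    [Fintype G] : (PclassGL n G).eval (-1) = 1 := by
  simp only [PclassGL, Polynomial.eval_mul, Polynomial.eval_C, Polynomial.eval_finsetSum,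
    eval_neg_one_det_matRatFuncPoly,
    inv_mul_cancel₀ (det_one_sub_X_smul_matRatFunc_ne_zero _), Finset.sum_const,
    Finset.card_univ, nsmul_eq_mul, mul_one]
  exact inv_mul_cancel₀ (Nat.cast_ne_zero.mpr Fintype.card_ne_zero)

/-- **Divisibility.** For any finite subgroup `G ⊆ GL(n, ℂ)`, `n ≥ 1`, the
polynomial `y + 1` divides `P_G − 1` in `F[y]`, `F = ℂ(T)`. -/
theorem divisibility_hirzebruch_molien
    (n : ℕ) (hn : 1 ≤ n)
    (G : Subgroup (Matrix.GeneralLinearGroup (Fin n) ℂ)) [Fintype G] :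
    (Polynomial.X + 1) ∣ (PclassGL n G - 1) := by
  have h_root : (PclassGL n G - 1).IsRoot (-1) := by
    simp [Polynomial.IsRoot, eval_neg_one_PclassGL]
  simpa using Polynomial.dvd_iff_isRoot.mpr h_root
end

section
/- (Symplectic divisibility.) Let n ≥ 1 and let G be a finite subgroup of the symplectic group Sp(2n, ℂ). Then the polynomial T²·y + 1 divides P_G − (−y)^n in the polynomial ring F[y]. -/
open scoped BigOperators Polynomial

set_option synthInstance.maxHeartbeats 1000000

/-- A complex `2n × 2n` matrix (indexed by `Fin n ⊕ Fin n`) regarded over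
`F = ℂ(T)` (`RatFunc ℂ`). -/
noncomputable abbrev matSpRatFunc {n : ℕ}
    (g : Matrix (Fin n ⊕ Fin n) (Fin n ⊕ Fin n) ℂ) :
    Matrix (Fin n ⊕ Fin n) (Fin n ⊕ Fin n) (RatFunc ℂ) :=
  g.map (algebraMap ℂ (RatFunc ℂ))

/-- A complex `2n × 2n` matrix regarded over the polynomial ring `F[y]`, `F = ℂ(T)`. -/
noncomputable abbrev matSpRatFuncPoly {n : ℕ}
    (g : Matrix (Fin n ⊕ Fin n) (Fin n ⊕ Fin n) ℂ) :
    Matrix (Fin n ⊕ Fin n) (Fin n ⊕ Fin n) (Polynomial (RatFunc ℂ)) :=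
  g.map (fun c => Polynomial.C (algebraMap ℂ (RatFunc ℂ) c))

/-- `P_G := |G|⁻¹ · ∑_{g ∈ G} (det(1 − T·g))⁻¹ · det(1 + T·y·g) ∈ F[y]` for a finite
subgroup `G` of the symplectic group `Sp(2n, ℂ)`. -/
noncomputable def PclassSp (n : ℕ)
    (G : Subgroup ↥(Matrix.symplecticGroup (Fin n) ℂ)) [Fintype G] :
    Polynomial (RatFunc ℂ) :=
  Polynomial.C (Fintype.card G : RatFunc ℂ)⁻¹ *
    ∑ g : G,
      Polynomial.C (Matrix.det
          ((1 : Matrix (Fin n ⊕ Fin n) (Fin n ⊕ Fin n) (RatFunc ℂ)) -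
            (RatFunc.X : RatFunc ℂ) • matSpRatFunc
            ((g : ↥(Matrix.symplecticGroup (Fin n) ℂ)) :
              Matrix (Fin n ⊕ Fin n) (Fin n ⊕ Fin n) ℂ)))⁻¹ *
      Matrix.det (1 + (Polynomial.C (RatFunc.X : RatFunc ℂ) * Polynomial.X) • matSpRatFuncPoly
          ((g : ↥(Matrix.symplecticGroup (Fin n) ℂ)) :
            Matrix (Fin n ⊕ Fin n) (Fin n ⊕ Fin n) ℂ))

open Matrix in
/-- The characteristic polynomial of a symplectic matrix is palindromic. -/
theorem SymplecticGroup.det_one_sub_smul {l R : Type*} [DecidableEq l] [Fintype l] [CommRing R]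
    {A : Matrix (l ⊕ l) (l ⊕ l) R} (hA : A ∈ symplecticGroup l R) (t : R) :
    det (1 - t • A) = det (A - t • 1) := by
  have key : A * J l R * (1 - t • A)ᵀ = (A - t • 1) * J l R := by
    simp [mul_sub, sub_mul, mem_iff.mp hA]
  have h := congrArg det key
  rw [det_mul, det_mul, det_mul, det_eq_one hA, det_transpose, one_mul, mul_comm] at h
  exact (isUnit_det_J l R).mul_right_cancel h

open Matrix in
theorem SymplecticGroup.det_one_sub_inv_smul {l K : Type*} [DecidableEq l] [Fintype l] [Field K]
    {A : Matrix (l ⊕ l) (l ⊕ l) K} (hA : A ∈ symplecticGroup l K) {t : K} (ht : t ≠ 0) :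
    det (1 - t⁻¹ • A) = ((t ^ 2)⁻¹) ^ Fintype.card l * det (1 - t • A) := by
  have h : 1 - t⁻¹ • A = (-t⁻¹) • (A - t • 1) := by
    rw [smul_sub, smul_smul, neg_mul, inv_mul_cancel₀ ht]
    simp [sub_eq_add_neg, add_comm]
  rw [h, det_smul, det_one_sub_smul hA, Fintype.card_sum, ← two_mul, pow_mul, neg_sq, inv_pow]

theorem RatFunc.det_one_sub_X_smul_ne_zero {m K : Type*} [DecidableEq m] [Fintype m] [Field K]
    (M : Matrix m m K) :
    Matrix.det (1 - (RatFunc.X : RatFunc K) • M.map (algebraMap K (RatFunc K))) ≠ 0 := by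
  have h : Matrix.det (1 - (RatFunc.X : RatFunc K) • M.map (algebraMap K (RatFunc K))) =
      algebraMap K[X] (RatFunc K) M.charpolyRev := by
    rw [Matrix.charpolyRev, RingHom.map_det]
    congr 1
    ext i j
    by_cases hij : i = j <;>
      simp [hij, RatFunc.algebraMap_X, RatFunc.algebraMap_C, RatFunc.algebraMap_eq_C,
        mul_comm RatFunc.X]
  rw [h]
  refine RatFunc.algebraMap_ne_zero fun h0 => ?_
  have := M.eval_charpolyRev
  simp [h0] at this

theorem eval_det_one_add_smul {m R : Type*} [DecidableEq m] [Fintype m] [CommRing R]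
    (M : Matrix m m R) (a x : R) :
    (Matrix.det (1 + (Polynomial.C a * Polynomial.X) • M.map Polynomial.C)).eval x =
      Matrix.det (1 + (a * x) • M) := by
  rw [← Polynomial.coe_evalRingHom, RingHom.map_det]
  congr 1
  ext i j
  by_cases hij : i = j <;> simp [hij]

/-- **Symplectic divisibility.** For a finite subgroup `G ⊆ Sp(2n, ℂ)`, `n ≥ 1`, the
polynomial `T²·y + 1` divides `P_G − (−y)^n` in `F[y]`, `F = ℂ(T)`. -/
theorem symplectic_divisibility
    (n : ℕ) (hn : 1 ≤ n)
    (G : Subgroup ↥(Matrix.symplecticGroup (Fin n) ℂ)) [Fintype G] :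
    (Polynomial.C ((RatFunc.X : RatFunc ℂ) ^ 2) * Polynomial.X + 1) ∣
      (PclassSp n G - (-Polynomial.X) ^ n) := by
  have hT : (RatFunc.X : RatFunc ℂ) ≠ 0 := RatFunc.X_ne_zero
  have hfac : (Polynomial.C ((RatFunc.X : RatFunc ℂ) ^ 2) * Polynomial.X + 1) =
      Polynomial.C ((RatFunc.X : RatFunc ℂ) ^ 2) *
        (Polynomial.X - Polynomial.C (-((RatFunc.X : RatFunc ℂ) ^ 2)⁻¹)) := by
    rw [mul_sub, ← Polynomial.C_mul, mul_neg, mul_inv_cancel₀ (pow_ne_zero 2 hT)]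
    simp
  have hunit : IsUnit (Polynomial.C ((RatFunc.X : RatFunc ℂ) ^ 2)) :=
    Polynomial.isUnit_C.mpr (pow_ne_zero 2 hT).isUnit
  rw [hfac, hunit.mul_left_dvd, Polynomial.dvd_iff_isRoot, Polynomial.IsRoot, Polynomial.eval_sub,
    sub_eq_zero]
  have hterm (g : G) :
      (Matrix.det (1 - (RatFunc.X : RatFunc ℂ) •
        matSpRatFunc (g : Matrix.symplecticGroup (Fin n) ℂ).1))⁻¹ *
        (Matrix.det (1 + (Polynomial.C (RatFunc.X : RatFunc ℂ) * Polynomial.X) •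
          matSpRatFuncPoly (g : Matrix.symplecticGroup (Fin n) ℂ).1)).eval
            (-((RatFunc.X : RatFunc ℂ) ^ 2)⁻¹) =
      (((RatFunc.X : RatFunc ℂ) ^ 2)⁻¹) ^ n := by
    have hmap : matSpRatFuncPoly (g : Matrix.symplecticGroup (Fin n) ℂ).1 =
        (matSpRatFunc (g : Matrix.symplecticGroup (Fin n) ℂ).1).map Polynomial.C := by
      rw [Matrix.map_map]; rfl
    have hx : (RatFunc.X : RatFunc ℂ) * -((RatFunc.X : RatFunc ℂ) ^ 2)⁻¹ = -(RatFunc.X)⁻¹ := by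
      field_simp
    rw [hmap, eval_det_one_add_smul, hx, neg_smul, ← sub_eq_add_neg,
      SymplecticGroup.det_one_sub_inv_smul
        (SymplecticGroup.map_mem (g : Matrix.symplecticGroup (Fin n) ℂ).2 _) hT,
      Fintype.card_fin, mul_left_comm,
      inv_mul_cancel₀ (RatFunc.det_one_sub_X_smul_ne_zero _), mul_one]
  have hcard : (Fintype.card G : RatFunc ℂ) ≠ 0 := Nat.cast_ne_zero.mpr Fintype.card_ne_zero
  simp only [PclassSp, Polynomial.eval_mul, Polynomial.eval_C, Polynomial.eval_finsetSum,
    Polynomial.eval_pow, Polynomial.eval_neg, Polynomial.eval_X, neg_neg]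
  rw [Finset.sum_congr rfl fun g _ => hterm g, Finset.sum_const, Finset.card_univ, nsmul_eq_mul,
    inv_mul_cancel_left₀ hcard]
end

section
/- Let n ≥ 1 and let G be a finite subgroup of the symplectic group Sp(2n, ℂ). Then the polynomial (y + 1)·(T²·y + 1) divides P_G − (−y)^n in the polynomial ring F[y]. -/
open scoped BigOperators Polynomial

set_option synthInstance.maxHeartbeats 1000000

namespace Matrix

variable {l : Type*} [DecidableEq l] [Fintype l]

/-- The characteristic polynomial of a symplectic matrix is self-reciprocal. -/
theorem det_smul_one_sub_of_mem_symplecticGroup {R : Type*} [CommRing R]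
    {A : Matrix (l ⊕ l) (l ⊕ l) R} (hA : A ∈ symplecticGroup l R) (t : R) :
    det (t • (1 : Matrix (l ⊕ l) (l ⊕ l) R) - A) = det (1 - t • A) := by
  have hJ : -J l R * J l R = 1 := by rw [neg_mul, J_squared, neg_neg]
  have hinv : A * (-J l R * Aᵀ * J l R) = 1 := by
    have h := SymplecticGroup.mem_iff.mp hA
    calc A * (-J l R * Aᵀ * J l R) = -(A * J l R * Aᵀ * J l R) := by
          simp only [neg_mul, mul_neg, Matrix.mul_assoc]
      _ = 1 := by rw [h, J_squared, neg_neg]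
  have hfactor : t • (1 : Matrix (l ⊕ l) (l ⊕ l) R) - A =
      A * -(-J l R * (1 - t • Aᵀ) * J l R) := by
    have h : -J l R * (1 - t • Aᵀ) * J l R = 1 - t • (-J l R * Aᵀ * J l R) := by
      rw [Matrix.mul_sub, Matrix.sub_mul, Matrix.mul_one, hJ, Matrix.mul_smul, Matrix.smul_mul]
    rw [h, neg_sub, Matrix.mul_sub, Matrix.mul_smul, hinv, Matrix.mul_one]
  have hcard : (-1 : R) ^ Fintype.card (l ⊕ l) = 1 := by
    rw [Fintype.card_sum]
    exact Even.neg_one_pow ⟨_, rfl⟩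
  have hdetJ : det (-J l R) * det (J l R) = 1 := by rw [← det_mul, hJ, det_one]
  have htr : det (1 - t • Aᵀ) = det (1 - t • A) := by
    rw [← det_transpose, transpose_sub, transpose_smul, transpose_transpose, transpose_one]
  rw [hfactor, det_mul, SymplecticGroup.det_eq_one hA, one_mul, det_neg, hcard, one_mul,
    det_mul, det_mul, htr, mul_right_comm, hdetJ, one_mul]

theorem det_one_sub_inv_smul_of_mem_symplecticGroup {F : Type*} [Field F]
    {A : Matrix (l ⊕ l) (l ⊕ l) F} (hA : A ∈ symplecticGroup l F) {t : F} (ht : t ≠ 0) :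
    det (1 - t⁻¹ • A) = (t⁻¹ ^ 2) ^ Fintype.card l * det (1 - t • A) := by
  have h : 1 - t⁻¹ • A = t⁻¹ • (t • (1 : Matrix (l ⊕ l) (l ⊕ l) F) - A) := by
    rw [smul_sub, smul_smul, inv_mul_cancel₀ ht, one_smul]
  rw [h, det_smul, det_smul_one_sub_of_mem_symplecticGroup hA, Fintype.card_sum, ← two_mul,
    pow_mul]

theorem det_one_sub_X_smul_map_ne_zero {m K : Type*} [DecidableEq m] [Fintype m] [Field K]
    (A : Matrix m m K) :
    det (1 - (RatFunc.X : RatFunc K) • A.map (algebraMap K (RatFunc K))) ≠ 0 := by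
  have h : det (1 - (RatFunc.X : RatFunc K) • A.map (algebraMap K (RatFunc K))) =
      algebraMap K[X] (RatFunc K) A.charpolyRev := by
    rw [charpolyRev, RingHom.map_det]
    congr 1
    ext i j
    by_cases hij : i = j <;>
      simp [hij, RatFunc.algebraMap_eq_C, mul_comm RatFunc.X]
  rw [h, Ne, FaithfulSMul.algebraMap_eq_zero_iff]
  intro h0
  have := A.eval_charpolyRev
  simp [h0] at this

end Matrix

theorem Polynomial.eval_det_one_add_smul_map_C {m R : Type*} [DecidableEq m] [Fintype m]
    [CommRing R] (A : Matrix m m R) (p : R[X]) (y : R) :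
    (Matrix.det (1 + p • A.map Polynomial.C)).eval y = Matrix.det (1 + p.eval y • A) := by
  rw [← Polynomial.coe_evalRingHom, RingHom.map_det]
  congr 1
  ext i j
  by_cases hij : i = j <;> simp [hij]

theorem RatFunc.one_sub_X_sq_ne_zero {K : Type*} [Field K] :
    (1 - (RatFunc.X : RatFunc K) ^ 2) ≠ 0 := by
  have h : (1 - (RatFunc.X : RatFunc K) ^ 2) =
      algebraMap K[X] (RatFunc K) (1 - Polynomial.X ^ 2) := by
    simp
  rw [h, Ne, FaithfulSMul.algebraMap_eq_zero_iff]
  intro h0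
  simpa using congrArg (Polynomial.eval 0) h0

/-- If evaluation at `y` turns each numerator of `PclassSp n G` into `c` times the corresponding
denominator, then `PclassSp n G` takes the value `c` at `y`. -/
theorem eval_PclassSp_eq (n : ℕ) (G : Subgroup ↥(Matrix.symplecticGroup (Fin n) ℂ)) [Fintype G]
    (y c : RatFunc ℂ)
    (h : ∀ A ∈ Matrix.symplecticGroup (Fin n) ℂ,
      Matrix.det (1 + (RatFunc.X * y) • matSpRatFunc A) =
        c * Matrix.det (1 - (RatFunc.X : RatFunc ℂ) • matSpRatFunc A)) :
    (PclassSp n G).eval y = c := by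
  have hterm : ∀ g : G,
      (Polynomial.C (Matrix.det
          ((1 : Matrix (Fin n ⊕ Fin n) (Fin n ⊕ Fin n) (RatFunc ℂ)) -
            (RatFunc.X : RatFunc ℂ) • matSpRatFunc
            ((g : ↥(Matrix.symplecticGroup (Fin n) ℂ)) :
              Matrix (Fin n ⊕ Fin n) (Fin n ⊕ Fin n) ℂ)))⁻¹ *
        Matrix.det (1 + (Polynomial.C (RatFunc.X : RatFunc ℂ) * Polynomial.X) • matSpRatFuncPoly
          ((g : ↥(Matrix.symplecticGroup (Fin n) ℂ)) :
            Matrix (Fin n ⊕ Fin n) (Fin n ⊕ Fin n) ℂ))).eval y = c := by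
    intro g
    have hmap : matSpRatFuncPoly (g : ↥(Matrix.symplecticGroup (Fin n) ℂ)).1 =
        (matSpRatFunc (g : ↥(Matrix.symplecticGroup (Fin n) ℂ)).1).map Polynomial.C := by
      ext i j
      simp
    rw [hmap, Polynomial.eval_mul, Polynomial.eval_det_one_add_smul_map_C, Polynomial.eval_C,
      Polynomial.eval_mul, Polynomial.eval_C, Polynomial.eval_X,
      h _ (g : ↥(Matrix.symplecticGroup (Fin n) ℂ)).2, mul_left_comm,
      inv_mul_cancel₀ (Matrix.det_one_sub_X_smul_map_ne_zero _), mul_one]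
  rw [PclassSp, Polynomial.eval_mul, Polynomial.eval_C, Polynomial.eval_finsetSum,
    Finset.sum_congr rfl fun g _ => hterm g, Finset.sum_const, Finset.card_univ, nsmul_eq_mul,
    inv_mul_cancel_left₀ (Nat.cast_ne_zero.mpr Fintype.card_ne_zero)]

/-- For a finite subgroup `G ⊆ Sp(2n, ℂ)`, `n ≥ 1`, the polynomial
`(y + 1)·(T²·y + 1)` divides `P_G − (−y)^n` in `F[y]`, `F = ℂ(T)`. -/
theorem symplectic_divisibility_strong
    (n : ℕ) (hn : 1 ≤ n)
    (G : Subgroup ↥(Matrix.symplecticGroup (Fin n) ℂ)) [Fintype G] :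
    ((Polynomial.X + 1) * (Polynomial.C ((RatFunc.X : RatFunc ℂ) ^ 2) * Polynomial.X + 1)) ∣
      (PclassSp n G - (-Polynomial.X) ^ n) := by
  have hX : (RatFunc.X : RatFunc ℂ) ≠ 0 := RatFunc.X_ne_zero
  have hD := RatFunc.one_sub_X_sq_ne_zero (K := ℂ)
  refine IsCoprime.mul_dvd ?_ ?_ ?_
  · refine ⟨-Polynomial.C (RatFunc.X ^ 2 * (1 - RatFunc.X ^ 2)⁻¹),
      Polynomial.C (1 - RatFunc.X ^ 2)⁻¹, ?_⟩
    have h : Polynomial.C (1 - (RatFunc.X : RatFunc ℂ) ^ 2)⁻¹ *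
        (1 - Polynomial.C (RatFunc.X ^ 2)) = 1 := by
      rw [← Polynomial.C_1, ← Polynomial.C_sub, ← Polynomial.C_mul, inv_mul_cancel₀ hD]
    rw [Polynomial.C_mul]
    linear_combination h
  · rw [← sub_neg_eq_add, ← Polynomial.C_1, ← Polynomial.C_neg, Polynomial.dvd_iff_isRoot,
      Polynomial.IsRoot.def, Polynomial.eval_sub, eval_PclassSp_eq n G (-1) 1]
    · simp
    · intro A _
      rw [mul_neg_one, neg_smul, ← sub_eq_add_neg, one_mul]
  · have hassoc : Polynomial.C ((RatFunc.X : RatFunc ℂ) ^ 2) * Polynomial.X + 1 =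
        Polynomial.C (RatFunc.X ^ 2) * (Polynomial.X - Polynomial.C (-(RatFunc.X⁻¹ ^ 2))) := by
      rw [mul_sub, ← Polynomial.C_mul, mul_neg, inv_pow, mul_inv_cancel₀ (pow_ne_zero 2 hX),
        Polynomial.C_neg, Polynomial.C_1, sub_neg_eq_add]
    rw [hassoc, (Polynomial.isUnit_C.mpr (pow_ne_zero 2 hX).isUnit).mul_left_dvd,
      Polynomial.dvd_iff_isRoot, Polynomial.IsRoot.def, Polynomial.eval_sub,
      eval_PclassSp_eq n G _ ((RatFunc.X⁻¹ ^ 2) ^ n)]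
    · simp
    · intro A hA
      have hinv : (RatFunc.X : RatFunc ℂ) * -(RatFunc.X⁻¹ ^ 2) = -RatFunc.X⁻¹ := by
        field_simp
      rw [hinv, neg_smul, ← sub_eq_add_neg, Matrix.det_one_sub_inv_smul_of_mem_symplecticGroup
        (SymplecticGroup.map_mem hA (algebraMap ℂ (RatFunc ℂ))) hX, Fintype.card_fin]
end

section
/- For symplectic surface quotient singularities: let G be a finite subgroup of SL(2, ℂ) (= Sp(2, ℂ)). Then H_G = (y + 1)·(y·T² + 1)·( |G|⁻¹ · Σ_{g ∈ G} (det(1 − T·g))⁻¹ ) − y in K, i.e. the paper's identity H(y,T) = (y+1)(yT²+1)·H(0,T) − y. -/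
open scoped BigOperators

/-- A complex `2 × 2` matrix regarded as a matrix over `K` via `ℂ ↪ K`. -/
noncomputable abbrev matK2 (g : Matrix (Fin 2) (Fin 2) ℂ) :
    Matrix (Fin 2) (Fin 2) MolienK :=
  g.map (algebraMap ℂ MolienK)

/-- `H_G := |G|⁻¹ · ∑_{g ∈ G} det(1 + y·T·g) / det(1 − T·g) ∈ K` for a finite
subgroup `G ⊆ SL(2, ℂ)`. -/
noncomputable def HsurfaceSL (G : Subgroup (Matrix.SpecialLinearGroup (Fin 2) ℂ))
    [Fintype G] : MolienK :=
  (Fintype.card G : MolienK)⁻¹ *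
    ∑ g : G, Matrix.det (1 + (molienY * molienT) • matK2
        ((g : Matrix.SpecialLinearGroup (Fin 2) ℂ) : Matrix (Fin 2) (Fin 2) ℂ)) /
      Matrix.det (1 - molienT • matK2
        ((g : Matrix.SpecialLinearGroup (Fin 2) ℂ) : Matrix (Fin 2) (Fin 2) ℂ))

/-- The determinant of `1 + c • g` over `K`, for `g` of determinant one. -/
theorem det_one_add_smul_matK2 (c : MolienK) (g : Matrix.SpecialLinearGroup (Fin 2) ℂ) :
    Matrix.det (1 + c • matK2 (g : Matrix (Fin 2) (Fin 2) ℂ)) =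
      1 + c * algebraMap ℂ MolienK (g 0 0 + g 1 1) + c ^ 2 := by
  have h := g.det_coe
  rw [Matrix.det_fin_two] at h
  have h' := congrArg (algebraMap ℂ MolienK) h
  simp only [map_sub, map_mul, map_one] at h'
  simp only [Matrix.det_fin_two, Matrix.add_apply, Matrix.smul_apply, Matrix.map_apply,
    Matrix.one_apply_eq, Matrix.one_apply_ne zero_ne_one, Matrix.one_apply_ne one_ne_zero,
    smul_eq_mul, map_add]
  linear_combination c ^ 2 * h'

/-- A quadratic polynomial in `T` with constant term one is nonzero in `K`. -/
theorem one_sub_molienT_mul_add_sq_ne_zero (a : ℂ) :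
    1 - molienT * algebraMap ℂ MolienK a + molienT ^ 2 ≠ 0 := by
  intro h
  have hp : algebraMap (MvPolynomial (Fin 2) ℂ) MolienK
      (1 - MvPolynomial.X 1 * MvPolynomial.C a + MvPolynomial.X 1 ^ 2) = 0 := by
    rw [← h, IsScalarTower.algebraMap_apply ℂ (MvPolynomial (Fin 2) ℂ) MolienK,
      MvPolynomial.algebraMap_eq]
    simp only [map_add, map_sub, map_mul, map_pow, map_one]
  have h0 := (map_eq_zero_iff _
    (IsFractionRing.injective (MvPolynomial (Fin 2) ℂ) MolienK)).mp hp
  simpa using congrArg (MvPolynomial.eval (0 : Fin 2 → ℂ)) h0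

/-- The summand identity behind `surface_symplectic_hirzebruch`. -/
theorem det_one_add_div_det_one_sub (g : Matrix.SpecialLinearGroup (Fin 2) ℂ) :
    Matrix.det (1 + (molienY * molienT) • matK2 (g : Matrix (Fin 2) (Fin 2) ℂ)) /
        Matrix.det (1 - molienT • matK2 (g : Matrix (Fin 2) (Fin 2) ℂ)) =
      (molienY + 1) * (molienY * molienT ^ 2 + 1) *
        (Matrix.det (1 - molienT • matK2 (g : Matrix (Fin 2) (Fin 2) ℂ)))⁻¹ - molienY := by
  have hd : Matrix.det (1 - molienT • matK2 (g : Matrix (Fin 2) (Fin 2) ℂ)) =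
      1 - molienT * algebraMap ℂ MolienK (g 0 0 + g 1 1) + molienT ^ 2 := by
    rw [sub_eq_add_neg, ← neg_smul, det_one_add_smul_matK2]
    ring
  have hne := one_sub_molienT_mul_add_sq_ne_zero (g 0 0 + g 1 1)
  rw [hd, det_one_add_smul_matK2]
  rw [div_eq_iff hne, sub_mul, mul_assoc _ _⁻¹, inv_mul_cancel₀ hne]
  ring

/-- **Symplectic surface quotient singularities.** For a finite subgroup
`G ⊆ SL(2, ℂ) = Sp(2, ℂ)` the Hirzebruch class satisfies
`H(y, T) = (y + 1)·(y·T² + 1)·H(0, T) − y` in `K = ℂ(y, T)`. -/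
theorem surface_symplectic_hirzebruch
    (G : Subgroup (Matrix.SpecialLinearGroup (Fin 2) ℂ)) [Fintype G] :
    HsurfaceSL G =
      (molienY + 1) * (molienY * molienT ^ 2 + 1) *
        ((Fintype.card G : MolienK)⁻¹ *
          ∑ g : G, (Matrix.det (1 - molienT • matK2
            ((g : Matrix.SpecialLinearGroup (Fin 2) ℂ) : Matrix (Fin 2) (Fin 2) ℂ)))⁻¹)
      - molienY := by
  have hcard : (Fintype.card G : MolienK) ≠ 0 := Nat.cast_ne_zero.mpr Fintype.card_ne_zero
  simp only [HsurfaceSL, det_one_add_div_det_one_sub]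
  rw [Finset.sum_sub_distrib, ← Finset.mul_sum, Finset.sum_const, Finset.card_univ,
    nsmul_eq_mul, mul_sub, inv_mul_cancel_left₀ hcard, mul_left_comm]
end

section
/- (Kaledin's age formula for symplectic matrices.) Let n ≥ 1 and let g ∈ Sp(2n, ℂ) have finite order (g^m = 1 for some m ≥ 1). For a nonzero complex number a define λ(a) ∈ [0,1) by λ(a) = arg(a)/(2π) if arg(a) ≥ 0 and λ(a) = arg(a)/(2π) + 1 otherwise, where arg is the principal argument (so a = e^{2πi·λ(a)} whenever |a| = 1). Then the sum of λ(a) over the multiset of roots, counted with multiplicity, of the characteristic polynomial of g equals n − (1/2)·dim_ℂ ker(g − 1); that is, age(g) equals half the codimension of the fixed subspace of g. -/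
/-- For a nonzero complex number `a`, the unique `λ(a) ∈ [0, 1)` with
`a = e^{2πi·λ(a)}` whenever `|a| = 1`: `λ(a) = arg(a)/2π` if `arg(a) ≥ 0` and
`λ(a) = arg(a)/2π + 1` otherwise. -/
noncomputable def rootAge (a : ℂ) : ℝ :=
  if 0 ≤ Complex.arg a then Complex.arg a / (2 * Real.pi)
  else Complex.arg a / (2 * Real.pi) + 1

open Module in
/-- For a matrix of finite order over `ℂ`, algebraic and geometric multiplicities agree. -/
theorem rootMultiplicity_charpoly_eq_finrank_of_pow_eq_one {ι : Type*} [Fintype ι] [DecidableEq ι]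
    {g : Matrix ι ι ℂ} {m : ℕ} (hm : m ≠ 0) (hord : g ^ m = 1) (a : ℂ) :
    g.charpoly.rootMultiplicity a = finrank ℂ (End.eigenspace (Matrix.toLin' g) a) := by
  have hpow : Matrix.toLin' g ^ m = 1 := by
    rw [← Matrix.toLin'_pow, hord, Matrix.toLin'_one]
    rfl
  have hss : End.IsSemisimple (Matrix.toLin' g) := by
    refine End.isSemisimple_of_squarefree_aeval_eq_zero
      (p := Polynomial.X ^ m - Polynomial.C (1 : ℂ)) ?_ ?_
    · exact (Polynomial.separable_X_pow_sub_C 1 (by exact_mod_cast hm) one_ne_zero).squarefree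
    · simp [hpow]
  rw [← hss.isFinitelySemisimple.maxGenEigenspace_eq_eigenspace,
    LinearMap.finrank_maxGenEigenspace_eq, Matrix.charpoly_toLin']

/-- Inverse matrices have the same eigenspaces, for inverse eigenvalues. -/
theorem eigenspace_toLin'_le_of_mul_eq_one {ι : Type*} [Fintype ι] [DecidableEq ι]
    {g h : Matrix ι ι ℂ} (hgh : h * g = 1) {a : ℂ} (ha : a ≠ 0) :
    Module.End.eigenspace (Matrix.toLin' g) a ≤ Module.End.eigenspace (Matrix.toLin' h) a⁻¹ := by
  intro v hv
  rw [Module.End.mem_eigenspace_iff, Matrix.toLin'_apply] at hv ⊢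
  have : h.mulVec (g.mulVec v) = v := by rw [Matrix.mulVec_mulVec, hgh, Matrix.one_mulVec]
  rw [hv, Matrix.mulVec_smul] at this
  rw [eq_inv_smul_iff₀ ha, this]

theorem charpoly_inv_of_mem_symplecticGroup {l : Type*} [Fintype l] [DecidableEq l]
    {g : Matrix (l ⊕ l) (l ⊕ l) ℂ} (hg : g ∈ Matrix.symplecticGroup l ℂ) :
    g⁻¹.charpoly = g.charpoly := by
  rw [SymplecticGroup.inv_eq_symplectic_inv g hg, Matrix.charpoly_mul_comm, ← mul_assoc,
    mul_neg, Matrix.J_squared, neg_neg, one_mul, Matrix.charpoly_transpose]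

theorem roots_charpoly_map_inv_of_mem_symplecticGroup {l : Type*} [Fintype l] [DecidableEq l]
    {g : Matrix (l ⊕ l) (l ⊕ l) ℂ} (hg : g ∈ Matrix.symplecticGroup l ℂ)
    {m : ℕ} (hm : m ≠ 0) (hord : g ^ m = 1) :
    g.charpoly.roots.map (·⁻¹) = g.charpoly.roots := by
  have hdet := SymplecticGroup.symplectic_det hg
  have hord' : g⁻¹ ^ m = 1 := by rw [Matrix.inv_pow', hord, inv_one]
  ext a
  rw [← inv_inv a, Multiset.count_map_eq_count' _ _ inv_injective, Polynomial.count_roots,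
    Polynomial.count_roots, inv_inv]
  by_cases ha : a = 0
  · simp [ha]
  conv_rhs => rw [← charpoly_inv_of_mem_symplecticGroup hg]
  rw [rootMultiplicity_charpoly_eq_finrank_of_pow_eq_one hm hord,
    rootMultiplicity_charpoly_eq_finrank_of_pow_eq_one hm hord']
  have heig : Module.End.eigenspace (Matrix.toLin' g) a⁻¹ =
      Module.End.eigenspace (Matrix.toLin' g⁻¹) a := by
    refine le_antisymm ?_ (eigenspace_toLin'_le_of_mul_eq_one (Matrix.mul_nonsing_inv g hdet) ha)
    have hle := eigenspace_toLin'_le_of_mul_eq_one (Matrix.nonsing_inv_mul g hdet) (inv_ne_zero ha)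
    rwa [inv_inv] at hle
  rw [heig]

theorem rootAge_one : rootAge 1 = 0 := by simp [rootAge]

theorem rootAge_add_rootAge_inv {a : ℂ} (ha : ‖a‖ = 1) (ha1 : a ≠ 1) :
    rootAge a + rootAge a⁻¹ = 1 := by
  have hpi := Real.pi_pos
  have harg : a.arg ≠ 0 := by
    intro h
    have := Complex.norm_mul_exp_arg_mul_I a
    simp [h, ha] at this
    exact ha1 this.symm
  unfold rootAge
  rw [Complex.arg_inv]
  split_ifs <;> grind

/-- **Kaledin's age formula for symplectic matrices.** Let `g ∈ Sp(2n, ℂ)`, `n ≥ 1`,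
have finite order. Then the sum of `λ(a)` over the multiset of roots (with
multiplicity) of the characteristic polynomial of `g` equals
`n − (1/2)·dim ker(g − 1)`: the age of `g` is half the codimension of its fixed
subspace. -/
theorem age_symplectic_eq_half_codim_fixed
    (n : ℕ) (hn : 1 ≤ n)
    (g : Matrix (Fin n ⊕ Fin n) (Fin n ⊕ Fin n) ℂ)
    (hg : g ∈ Matrix.symplecticGroup (Fin n) ℂ)
    (m : ℕ) (hm : 1 ≤ m) (hord : g ^ m = 1) :
    ((Matrix.charpoly g).roots.map rootAge).sum
      = (n : ℝ) - (Module.finrank ℂ (LinearMap.ker (Matrix.toLin' (g - 1))) : ℝ) / 2 := by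
  have hm0 : m ≠ 0 := by omega
  have hker : LinearMap.ker (Matrix.toLin' (g - 1)) =
      Module.End.eigenspace (Matrix.toLin' g) 1 := by
    ext v
    simp [sub_eq_zero]
  rw [hker, ← rootMultiplicity_charpoly_eq_finrank_of_pow_eq_one hm0 hord, ← Polynomial.count_roots]
  have hcard : g.charpoly.roots.card = 2 * n := by
    rw [← (IsAlgClosed.splits g.charpoly).natDegree_eq_card_roots, Matrix.charpoly_natDegree_eq_dim]
    simp [two_mul]
  have hnorm : ∀ a ∈ g.charpoly.roots, ‖a‖ = 1 := by
    intro a ha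
    have hpos : 0 < g.charpoly.rootMultiplicity a := by
      rwa [← Polynomial.count_roots, Multiset.count_pos]
    rw [rootMultiplicity_charpoly_eq_finrank_of_pow_eq_one hm0 hord] at hpos
    have hev : Module.End.HasEigenvalue (Matrix.toLin' g) a := by
      rw [Module.End.hasEigenvalue_iff]
      exact Submodule.one_le_finrank_iff.mp hpos
    obtain ⟨v, hv⟩ := hev.exists_hasEigenvector
    have hpow := hv.pow_apply m
    rw [← Matrix.toLin'_pow, hord, Matrix.toLin'_one, LinearMap.id_apply] at hpow
    refine Complex.norm_eq_one_of_pow_eq_one (n := m) ?_ hm0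
    refine smul_left_injective ℂ hv.2 ?_
    simpa using hpow.symm
  have hsum : (g.charpoly.roots.map fun a => rootAge a + rootAge a⁻¹).sum =
      (g.charpoly.roots.map fun a => (1 : ℝ) - if a = 1 then 1 else 0).sum := by
    refine congrArg _ (Multiset.map_congr rfl fun a ha => ?_)
    split_ifs with h
    · simp [h, rootAge_one]
    · simpa using rootAge_add_rootAge_inv (hnorm a ha) h
  have hinv : (g.charpoly.roots.map fun a => rootAge a⁻¹).sum =
      (g.charpoly.roots.map rootAge).sum := by
    conv_rhs => rw [← roots_charpoly_map_inv_of_mem_symplecticGroup hg hm0 hord]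
    rw [Multiset.map_map]
    rfl
  have hcount : (g.charpoly.roots.map fun a => if a = 1 then (1 : ℝ) else 0).sum =
      g.charpoly.roots.count 1 := by
    induction g.charpoly.roots using Multiset.induction with
    | empty => simp
    | cons a s ih =>
      rw [Multiset.map_cons, Multiset.sum_cons, ih, Multiset.count_cons]
      by_cases h : a = 1 <;> simp [h, eq_comm, add_comm]
  rw [Multiset.sum_map_add, Multiset.sum_map_sub, hinv, hcount] at hsum
  simp [hcard] at hsum ⊢
  linarith
end

section
/- Let n ≥ 1 and let G be a finite subgroup of Sp(2n, ℂ). Then the polynomial (y + 1)·(T²·y + 1) divides H̃_G − (−y)^n · c in F[y], where c is the number of conjugacy classes of G. -/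
open scoped BigOperators Classical

set_option synthInstance.maxHeartbeats 1000000
set_option maxHeartbeats 1000000

noncomputable section

/-- The fixed subspace `V_h = ker(h − 1) ⊆ ℂ^{2n}` of a `2n × 2n` complex matrix `h`
(indexed by `Fin n ⊕ Fin n`). -/
def fixedSpace {n : ℕ} (h : Matrix (Fin n ⊕ Fin n) (Fin n ⊕ Fin n) ℂ) :
    Submodule ℂ ((Fin n ⊕ Fin n) → ℂ) :=
  LinearMap.ker (Matrix.toLin' (h - 1))

/-- If `g` commutes with `h` then `g` preserves the fixed subspace `V_h = ker(h − 1)`. -/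
theorem fixedSpace_invariant {n : ℕ}
    {g h : Matrix (Fin n ⊕ Fin n) (Fin n ⊕ Fin n) ℂ} (hc : g * h = h * g) :
    ∀ x ∈ fixedSpace h, Matrix.toLin' g x ∈ fixedSpace h := by
  intro x hx
  rw [fixedSpace, LinearMap.mem_ker] at hx ⊢
  have h1 : Matrix.toLin' (h - 1) (Matrix.toLin' g x) = Matrix.toLin' ((h - 1) * g) x := by
    rw [Matrix.toLin'_mul]; rfl
  have h2 : (h - 1) * g = g * (h - 1) := by
    rw [sub_mul, mul_sub, one_mul, mul_one, hc]
  rw [h1, h2, Matrix.toLin'_mul, LinearMap.comp_apply, hx, map_zero]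

/-- The underlying complex matrix of an element of a subgroup `G ⊆ Sp(2n, ℂ)`. -/
def spMat {n : ℕ} {G : Subgroup ↥(Matrix.symplecticGroup (Fin n) ℂ)} (g : G) :
    Matrix (Fin n ⊕ Fin n) (Fin n ⊕ Fin n) ℂ :=
  ((g : ↥(Matrix.symplecticGroup (Fin n) ℂ)) : Matrix (Fin n ⊕ Fin n) (Fin n ⊕ Fin n) ℂ)

/-- Elements of the centralizer `C(h)` commute with `h` as matrices. -/
theorem spMat_commute {n : ℕ} {G : Subgroup ↥(Matrix.symplecticGroup (Fin n) ℂ)}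
    (h : G) (g : ↥(Subgroup.centralizer ({h} : Set G))) :
    spMat (g : G) * spMat h = spMat h * spMat (g : G) := by
  have hgh : h * (g : G) = (g : G) * h := Subgroup.mem_centralizer_iff.mp g.2 h rfl
  have := congrArg (fun x : G =>
    ((x : ↥(Matrix.symplecticGroup (Fin n) ℂ)) :
      Matrix (Fin n ⊕ Fin n) (Fin n ⊕ Fin n) ℂ)) hgh
  simpa [spMat] using this.symm

/-- The endomorphism of the fixed subspace `V_h` induced by restriction of
`g ∈ C(h)`. -/
def restrictToFixed {n : ℕ} {G : Subgroup ↥(Matrix.symplecticGroup (Fin n) ℂ)}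
    (h : G) (g : ↥(Subgroup.centralizer ({h} : Set G))) :
    fixedSpace (spMat h) →ₗ[ℂ] fixedSpace (spMat h) :=
  (Matrix.toLin' (spMat (g : G))).restrict (fixedSpace_invariant (spMat_commute h g))

/-- The matrix (in some fixed basis of `V_h`; determinants below are independent of
this choice) of the endomorphism of `V_h` induced by `g ∈ C(h)`. -/
def restrictMat {n : ℕ} {G : Subgroup ↥(Matrix.symplecticGroup (Fin n) ℂ)}
    (h : G) (g : ↥(Subgroup.centralizer ({h} : Set G))) :
    Matrix (Fin (Module.finrank ℂ (fixedSpace (spMat h))))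
      (Fin (Module.finrank ℂ (fixedSpace (spMat h)))) ℂ :=
  LinearMap.toMatrix (Module.finBasis ℂ (fixedSpace (spMat h)))
    (Module.finBasis ℂ (fixedSpace (spMat h))) (restrictToFixed h g)

/-- The age of a symplectic `h`: `age(h) = n − d_h/2` where `d_h = dim V_h`; for
symplectic `h` this equals `∑ λ_k` over the eigenvalues `e^{2πiλ_k}`, `λ_k ∈ [0,1)`,
of `h`. -/
def spAge {n : ℕ} {G : Subgroup ↥(Matrix.symplecticGroup (Fin n) ℂ)} (h : G) : ℕ :=
  n - Module.finrank ℂ (fixedSpace (spMat h)) / 2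

/-- `det(1 − T·g|_{V_h}) ∈ F = ℂ(T)`: the determinant of the endomorphism
`1 − T·(g restricted to V_h)` after base change to `F`. -/
def detFixedF {n : ℕ} {G : Subgroup ↥(Matrix.symplecticGroup (Fin n) ℂ)}
    (h : G) (g : ↥(Subgroup.centralizer ({h} : Set G))) : RatFunc ℂ :=
  Matrix.det
    ((1 : Matrix (Fin (Module.finrank ℂ (fixedSpace (spMat h))))
        (Fin (Module.finrank ℂ (fixedSpace (spMat h)))) (RatFunc ℂ)) -
      (RatFunc.X : RatFunc ℂ) • (restrictMat h g).map (algebraMap ℂ (RatFunc ℂ)))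

/-- `det(1 + T·y·g|_{V_h}) ∈ F[y]`: the determinant of the endomorphism
`1 + T·y·(g restricted to V_h)` after base change to `F[y]`, `F = ℂ(T)`. -/
def detFixedFy {n : ℕ} {G : Subgroup ↥(Matrix.symplecticGroup (Fin n) ℂ)}
    (h : G) (g : ↥(Subgroup.centralizer ({h} : Set G))) : Polynomial (RatFunc ℂ) :=
  Matrix.det
    ((1 : Matrix (Fin (Module.finrank ℂ (fixedSpace (spMat h))))
        (Fin (Module.finrank ℂ (fixedSpace (spMat h)))) (Polynomial (RatFunc ℂ))) +
      (Polynomial.C (RatFunc.X : RatFunc ℂ) * Polynomial.X) •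
        (restrictMat h g).map (fun c => Polynomial.C (algebraMap ℂ (RatFunc ℂ) c)))

/-- `H̃_G := |G|⁻¹ ∑_{h ∈ G} (−y)^{age(h)} ∑_{g ∈ C(h)} (det(1 − T·g|_{V_h}))⁻¹ ·
det(1 + T·y·g|_{V_h}) ∈ F[y]`, i.e. the sum over conjugacy classes `[h]` of
`(−y)^{age(h)}·Mol(C(h), (ℂ^{2n})^h; yT, T)`: the Hirzebruch class of a crepant
resolution of `ℂ^{2n}/G`. -/
def Htilde (n : ℕ) (G : Subgroup ↥(Matrix.symplecticGroup (Fin n) ℂ)) [Fintype G] :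
    Polynomial (RatFunc ℂ) :=
  Polynomial.C (Fintype.card G : RatFunc ℂ)⁻¹ *
    ∑ h : G, (-Polynomial.X) ^ spAge h *
      ∑ g : ↥(Subgroup.centralizer ({h} : Set G)),
        Polynomial.C (detFixedF h g)⁻¹ * detFixedFy h g

open Matrix in
/-- If `M` preserves a nondegenerate form `B` and has determinant one, in even dimension, then
its reversed characteristic polynomial is palindromic. -/
theorem det_one_sub_smul_eq_pow_mul {K m : Type*} [Field K] [Fintype m] [DecidableEq m]
    {B M : Matrix m m K} (hB : B.det ≠ 0) (hM : Mᵀ * B * M = B) (hdet : M.det = 1)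
    (heven : Even (Fintype.card m)) {t : K} (ht : t ≠ 0) :
    (1 - t • M).det = t ^ Fintype.card m * (1 - t⁻¹ • M).det := by
  have h1 : B * (1 - t • M) = (Mᵀ - t • 1) * B * M := by
    rw [sub_mul, sub_mul, hM, mul_sub, mul_one, Matrix.mul_smul, Matrix.smul_mul,
      Matrix.smul_mul, one_mul]
  have h2 : (Mᵀ - t • (1 : Matrix m m K)).det = t ^ Fintype.card m * (1 - t⁻¹ • M).det := by
    rw [← det_smul, ← det_transpose, transpose_sub, transpose_transpose, ← neg_sub, det_neg,
      heven.neg_one_pow, one_mul, smul_sub, smul_smul, mul_inv_cancel₀ ht]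
    simp
  have h3 := congrArg det h1
  rw [det_mul, det_mul, det_mul, hdet, mul_one, h2, mul_comm] at h3
  exact mul_right_cancel₀ hB h3

open Matrix in
/-- A nondegenerate skew-symmetric form lives in even dimension. -/
theorem even_card_of_transpose_eq_neg {K m : Type*} [Field K] [CharZero K] [Fintype m]
    [DecidableEq m] {B : Matrix m m K} (hB : B.det ≠ 0) (hskew : Bᵀ = -B) :
    Even (Fintype.card m) := by
  by_contra hodd
  rw [Nat.not_even_iff_odd] at hodd
  have h := congrArg det hskew
  rw [det_transpose, det_neg, hodd.neg_one_pow, neg_one_mul] at h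
  exact hB (self_eq_neg.mp h)

/-- The average of the powers `1, H, …, H ^ (k - 1)`. -/
def powAverage {m : Type*} [Fintype m] [DecidableEq m] (H : Matrix m m ℂ) (k : ℕ) : Matrix m m ℂ :=
  (k : ℂ)⁻¹ • ∑ i ∈ Finset.range k, H ^ i

section powAverage

open Matrix

variable {m : Type*} [Fintype m] [DecidableEq m] {H J g : Matrix m m ℂ} {k : ℕ}

theorem mul_powAverage (hH : H ^ k = 1) : H * powAverage H k = powAverage H k := by
  have h := mul_neg_geom_sum H k
  rw [hH, sub_self, sub_mul, one_mul, sub_eq_zero] at h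
  rw [powAverage, Matrix.mul_smul, ← h]

theorem commute_powAverage (hg : Commute g H) : Commute g (powAverage H k) :=
  (Commute.sum_right _ _ _ fun i _ => hg.pow_right i).smul_right _

theorem mul_powAverage_of_mul_eq {p : Type*} (hk : k ≠ 0) {A : Matrix p m ℂ} (hA : A * H = A) :
    A * powAverage H k = A := by
  have hpow : ∀ i, A * H ^ i = A := by
    intro i
    induction i with
    | zero => simp
    | succ i ih => rw [pow_succ, ← Matrix.mul_assoc, ih, hA]
  rw [powAverage, Matrix.mul_smul, Matrix.mul_sum, Finset.sum_congr rfl fun i _ => hpow i,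
    Finset.sum_const, Finset.card_range, ← Nat.cast_smul_eq_nsmul ℂ, smul_smul,
    inv_mul_cancel₀ (Nat.cast_ne_zero.mpr hk), one_smul]

theorem powAverage_mulVec_of_mulVec_eq (hk : k ≠ 0) {v : m → ℂ} (hv : H *ᵥ v = v) :
    powAverage H k *ᵥ v = v := by
  have hpow : ∀ i, H ^ i *ᵥ v = v := by
    intro i
    induction i with
    | zero => simp
    | succ i ih => rw [pow_succ, ← mulVec_mulVec, hv, ih]
  rw [powAverage, smul_mulVec, sum_mulVec, Finset.sum_congr rfl fun i _ => hpow i,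
    Finset.sum_const, Finset.card_range, ← Nat.cast_smul_eq_nsmul ℂ, smul_smul,
    inv_mul_cancel₀ (Nat.cast_ne_zero.mpr hk), one_smul]

/-- The averaging projector of an isometry of a skew-symmetric form is self-adjoint. -/
theorem transpose_powAverage_mul (hk : k ≠ 0) (hH : H ^ k = 1) (hJ : Jᵀ = -J)
    (hHJ : Hᵀ * J * H = J) : (powAverage H k)ᵀ * J = J * powAverage H k := by
  set P := powAverage H k with hP
  have h1 : Pᵀ * J * H = Pᵀ * J := by
    have h : Pᵀ = Pᵀ * Hᵀ := by rw [← transpose_mul, mul_powAverage hH]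
    calc Pᵀ * J * H = Pᵀ * Hᵀ * J * H := by rw [← h]
      _ = Pᵀ * (Hᵀ * J * H) := by simp only [Matrix.mul_assoc]
      _ = Pᵀ * J := by rw [hHJ]
  have h2 : Pᵀ * J * P = Pᵀ * J := mul_powAverage_of_mul_eq hk h1
  have h3 := congrArg transpose h2
  simp only [transpose_mul, transpose_transpose, hJ, Matrix.neg_mul, Matrix.mul_neg,
    neg_inj] at h3
  rw [← h2, Matrix.mul_assoc, h3]

end powAverage

section restriction

open Matrix

variable {K m p : Type*} [Field K] [Fintype m] [Fintype p] [DecidableEq p]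
  {J P g : Matrix m m K} {A : Matrix m p K} {C : Matrix p m K}

/-- The restriction of a nondegenerate form to the image of a self-adjoint projector is
nondegenerate. -/
theorem det_transpose_mul_mul_ne_zero [DecidableEq m] (hJ : J * J = -1) (hP : A * C = P)
    (hCA : C * A = 1) (hadj : Pᵀ * J = J * P) : (Aᵀ * J * A).det ≠ 0 := by
  have hPA : P * A = A := by rw [← hP, Matrix.mul_assoc, hCA, Matrix.mul_one]
  have h : Aᵀ * J * A * (C * (-J) * Cᵀ) = 1 := by
    calc Aᵀ * J * A * (C * (-J) * Cᵀ) = -(Aᵀ * (J * (A * C)) * J * Cᵀ) := by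
          simp only [Matrix.mul_assoc, Matrix.neg_mul, Matrix.mul_neg]
      _ = -((P * A)ᵀ * (J * J) * Cᵀ) := by
          rw [hP, ← hadj, transpose_mul]; simp only [Matrix.mul_assoc]
      _ = (C * A)ᵀ := by rw [hPA, hJ, transpose_mul]; simp
      _ = 1 := by rw [hCA, transpose_one]
  exact (isUnit_iff_isUnit_det _).mp (IsUnit.of_mul_eq_one _ h) |>.ne_zero

/-- The restriction of an isometry is an isometry of the restricted form. -/
theorem transpose_restriction_mul_mul (hP : A * C = P) (hCA : C * A = 1)
    (hcomm : P * g = g * P) (hg : gᵀ * J * g = J) :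
    (C * g * A)ᵀ * (Aᵀ * J * A) * (C * g * A) = Aᵀ * J * A := by
  have hPA : P * A = A := by rw [← hP, Matrix.mul_assoc, hCA, Matrix.mul_one]
  have hA : A * (C * g * A) = g * A := by
    calc A * (C * g * A) = A * C * g * A := by simp only [Matrix.mul_assoc]
      _ = g * (P * A) := by rw [hP, hcomm, Matrix.mul_assoc]
      _ = g * A := by rw [hPA]
  calc (C * g * A)ᵀ * (Aᵀ * J * A) * (C * g * A)
      = (A * (C * g * A))ᵀ * J * (A * (C * g * A)) := by
        rw [transpose_mul A]; simp only [Matrix.mul_assoc]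
    _ = Aᵀ * (gᵀ * J * g) * A := by rw [hA, transpose_mul]; simp only [Matrix.mul_assoc]
    _ = Aᵀ * J * A := by rw [hg]

/-- Extending an isometry commuting with a self-adjoint projector by the identity on the kernel
of the projector gives an isometry. -/
theorem transpose_one_add_mul_mul [DecidableEq m] (hPP : P * P = P) (hadj : Pᵀ * J = J * P)
    (hcomm : P * g = g * P) (hg : gᵀ * J * g = J) :
    (1 + (g - 1) * P)ᵀ * J * (1 + (g - 1) * P) = J := by
  set a := g - 1 with ha
  have hga : aᵀ * J * a + J * a + aᵀ * J = 0 := by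
    have hg' : g = 1 + a := by rw [ha]; abel
    rw [hg', transpose_add, transpose_one] at hg
    have h : J + (aᵀ * J * a + J * a + aᵀ * J) = J := by
      conv_rhs => rw [← hg]
      noncomm_ring
    simpa using h
  have hPa : P * a = a * P := by rw [ha, mul_sub, sub_mul, hcomm, mul_one, one_mul]
  have h1 : J * (a * P) = Pᵀ * (J * a) * P := by
    rw [← Matrix.mul_assoc Pᵀ, hadj, Matrix.mul_assoc J, hPa, Matrix.mul_assoc J,
      Matrix.mul_assoc a, hPP]
  have h2 : Pᵀ * aᵀ * J = Pᵀ * (aᵀ * J) * P := by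
    have hPaT : Pᵀ * aᵀ = aᵀ * Pᵀ := by rw [← transpose_mul, ← hPa, transpose_mul]
    have hPPT : Pᵀ * Pᵀ = Pᵀ := by rw [← transpose_mul, hPP]
    calc Pᵀ * aᵀ * J = aᵀ * (Pᵀ * Pᵀ) * J := by rw [hPPT, hPaT]
      _ = aᵀ * Pᵀ * (Pᵀ * J) := by simp only [Matrix.mul_assoc]
      _ = Pᵀ * (aᵀ * J) * P := by rw [hadj, ← hPaT]; simp only [Matrix.mul_assoc]
  calc (1 + a * P)ᵀ * J * (1 + a * P)
      = J + (Pᵀ * aᵀ * J * a * P + J * (a * P) + Pᵀ * aᵀ * J) := by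
        rw [transpose_add, transpose_one, transpose_mul]; noncomm_ring
    _ = J + Pᵀ * (aᵀ * J * a + J * a + aᵀ * J) * P := by
        have h3 : Pᵀ * aᵀ * J * a * P = Pᵀ * (aᵀ * J * a) * P := by
          simp only [Matrix.mul_assoc]
        rw [h3, h1, h2, mul_add, mul_add, add_mul, add_mul]
    _ = J := by rw [hga]; simp

theorem det_restriction [DecidableEq m] (hP : A * C = P) (hCA : C * A = 1) :
    (C * g * A).det = (1 + (g - 1) * P).det := by
  rw [← hP, ← Matrix.mul_assoc, det_one_add_mul_comm]
  congr 1
  rw [Matrix.sub_mul, Matrix.mul_sub, Matrix.one_mul, hCA, Matrix.mul_assoc]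
  abel

end restriction

section symplectic

open Matrix

variable {n : ℕ} {G : Subgroup ↥(Matrix.symplecticGroup (Fin n) ℂ)}

theorem spMat_pow (g : G) (k : ℕ) : spMat (g ^ k) = spMat g ^ k := by
  simp [spMat]

theorem spMat_isometry (g : G) :
    (spMat g)ᵀ * Matrix.J (Fin n) ℂ * spMat g = Matrix.J (Fin n) ℂ :=
  SymplecticGroup.mem_iff'.mp g.1.2

/-- The inclusion `V_h → ℂ^{2n}` in coordinates. -/
def fixedInclusion (h : Matrix (Fin n ⊕ Fin n) (Fin n ⊕ Fin n) ℂ) :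
    Matrix (Fin n ⊕ Fin n) (Fin (Module.finrank ℂ (fixedSpace h))) ℂ :=
  LinearMap.toMatrix (Module.finBasis ℂ (fixedSpace h)) (Pi.basisFun ℂ (Fin n ⊕ Fin n))
    (fixedSpace h).subtype

theorem mem_fixedSpace_iff {h : Matrix (Fin n ⊕ Fin n) (Fin n ⊕ Fin n) ℂ}
    {v : Fin n ⊕ Fin n → ℂ} : v ∈ fixedSpace h ↔ h *ᵥ v = v := by
  rw [fixedSpace, LinearMap.mem_ker, toLin'_apply, sub_mulVec, one_mulVec, sub_eq_zero]

/-- A projection onto `V_h` along an invariant complement, through which restrictions to `V_h`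
can be computed. -/
theorem exists_fixedProjection [Finite G] (h : G) :
    ∃ (P : Matrix (Fin n ⊕ Fin n) (Fin n ⊕ Fin n) ℂ)
      (C : Matrix (Fin (Module.finrank ℂ (fixedSpace (spMat h)))) (Fin n ⊕ Fin n) ℂ),
      fixedInclusion (spMat h) * C = P ∧ C * fixedInclusion (spMat h) = 1 ∧
      Pᵀ * Matrix.J (Fin n) ℂ = Matrix.J (Fin n) ℂ * P ∧
      ∀ g : ↥(Subgroup.centralizer ({h} : Set G)),
        P * spMat (g : G) = spMat (g : G) * P ∧
        restrictMat h g = C * spMat (g : G) * fixedInclusion (spMat h) := by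
  obtain ⟨k, hkpos, hk⟩ := isOfFinOrder_iff_pow_eq_one.mp (isOfFinOrder_of_finite h)
  have hH : spMat h ^ k = 1 := by rw [← spMat_pow, hk]; simp [spMat]
  set P := powAverage (spMat h) k with hP
  have hmem : ∀ v, toLin' P v ∈ fixedSpace (spMat h) := fun v => by
    rw [mem_fixedSpace_iff, toLin'_apply, mulVec_mulVec, hP, mul_powAverage hH]
  have hfix : ∀ v ∈ fixedSpace (spMat h), toLin' P v = v := fun v hv =>
    powAverage_mulVec_of_mulVec_eq hkpos.ne' (mem_fixedSpace_iff.mp hv)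
  have hlin : ∀ Q : Matrix (Fin n ⊕ Fin n) (Fin n ⊕ Fin n) ℂ,
      LinearMap.toMatrix (Pi.basisFun ℂ (Fin n ⊕ Fin n)) (Pi.basisFun ℂ (Fin n ⊕ Fin n))
        (toLin' Q) = Q := fun Q => by
    rw [LinearMap.toMatrix_eq_toMatrix', LinearMap.toMatrix'_toLin']
  refine ⟨P, LinearMap.toMatrix (Pi.basisFun ℂ (Fin n ⊕ Fin n))
    (Module.finBasis ℂ (fixedSpace (spMat h))) ((toLin' P).codRestrict _ hmem),
    ?_, ?_, transpose_powAverage_mul hkpos.ne' hH (Matrix.J_transpose _ _) (spMat_isometry h),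
    fun g => ⟨(commute_powAverage (spMat_commute h g)).eq.symm, ?_⟩⟩
  · rw [fixedInclusion, ← LinearMap.toMatrix_comp, LinearMap.subtype_comp_codRestrict, hlin]
  · rw [fixedInclusion, ← LinearMap.toMatrix_comp,
      ← LinearMap.toMatrix_id (Module.finBasis ℂ (fixedSpace (spMat h)))]
    congr 1
    ext v : 2
    exact hfix v v.2
  · conv_rhs => rw [← hlin (spMat (g : G))]
    rw [fixedInclusion, ← LinearMap.toMatrix_comp, ← LinearMap.toMatrix_comp, restrictMat]
    congr 1
    ext v : 2
    exact (hfix _ (fixedSpace_invariant (spMat_commute h g) v v.2)).symm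

/-- The restriction of `g` to `V_h` is an isometry, of determinant one, of a nondegenerate
skew-symmetric form. -/
theorem exists_form_restrictMat [Finite G] (h : G) :
    ∃ B : Matrix (Fin (Module.finrank ℂ (fixedSpace (spMat h))))
        (Fin (Module.finrank ℂ (fixedSpace (spMat h)))) ℂ,
      B.det ≠ 0 ∧ Bᵀ = -B ∧ ∀ g : ↥(Subgroup.centralizer ({h} : Set G)),
        (restrictMat h g)ᵀ * B * restrictMat h g = B ∧ (restrictMat h g).det = 1 := by
  obtain ⟨P, C, hP, hCA, hadj, hg⟩ := exists_fixedProjection h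
  set A := fixedInclusion (spMat h)
  have hPP : P * P = P := by
    rw [← hP, Matrix.mul_assoc, ← Matrix.mul_assoc C, hCA, Matrix.one_mul]
  refine ⟨Aᵀ * Matrix.J (Fin n) ℂ * A,
    det_transpose_mul_mul_ne_zero (Matrix.J_squared _ _) hP hCA hadj, ?_, fun g => ?_⟩
  · simp only [transpose_mul, transpose_transpose, Matrix.J_transpose, Matrix.mul_assoc,
      Matrix.neg_mul, Matrix.mul_neg]
  · obtain ⟨hcomm, hres⟩ := hg g
    rw [hres, transpose_restriction_mul_mul hP hCA hcomm (spMat_isometry _),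
      det_restriction hP hCA]
    exact ⟨rfl, SymplecticGroup.det_eq_one (SymplecticGroup.mem_iff'.mpr
      (transpose_one_add_mul_mul hPP hadj hcomm (spMat_isometry _)))⟩

theorem even_finrank_fixedSpace [Finite G] (h : G) :
    Even (Module.finrank ℂ (fixedSpace (spMat h))) := by
  obtain ⟨B, hB, hskew, -⟩ := exists_form_restrictMat h
  simpa using even_card_of_transpose_eq_neg hB hskew

theorem two_mul_spAge_add_finrank [Finite G] (h : G) :
    2 * spAge h + Module.finrank ℂ (fixedSpace (spMat h)) = 2 * n := by
  have hle : Module.finrank ℂ (fixedSpace (spMat h)) ≤ 2 * n := by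
    simpa [two_mul] using Submodule.finrank_le (fixedSpace (spMat h))
  have heven := even_finrank_fixedSpace h
  rw [spAge]
  grind

theorem detFixedF_ne_zero (h : G) (g : ↥(Subgroup.centralizer ({h} : Set G))) :
    detFixedF h g ≠ 0 := by
  have hrev : detFixedF h g =
      algebraMap (Polynomial ℂ) (RatFunc ℂ) (restrictMat h g).charpolyRev := by
    rw [charpolyRev, RingHom.map_det, detFixedF]
    congr 1
    ext i j
    by_cases hij : i = j <;>
      simp [hij, RatFunc.algebraMap_X, RatFunc.algebraMap_C, RatFunc.algebraMap_eq_C] <;>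
      exact mul_comm _ _
  rw [hrev, Ne, FaithfulSMul.algebraMap_eq_zero_iff]
  intro h0
  simpa [h0] using (restrictMat h g).eval_charpolyRev

theorem eval_detFixedFy (h : G) (g : ↥(Subgroup.centralizer ({h} : Set G))) (y : RatFunc ℂ) :
    (detFixedFy h g).eval y =
      (1 + (RatFunc.X * y) • (restrictMat h g).map (algebraMap ℂ (RatFunc ℂ))).det := by
  rw [detFixedFy, ← Polynomial.coe_evalRingHom, RingHom.map_det]
  congr 1
  ext i j
  by_cases hij : i = j <;> simp [hij]

theorem eval_neg_one_detFixedFy (h : G) (g : ↥(Subgroup.centralizer ({h} : Set G))) :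
    (detFixedFy h g).eval (-1) = detFixedF h g := by
  rw [eval_detFixedFy, detFixedF, mul_neg_one, neg_smul, ← sub_eq_add_neg]

theorem eval_neg_inv_sq_detFixedFy [Finite G] (h : G)
    (g : ↥(Subgroup.centralizer ({h} : Set G))) :
    RatFunc.X ^ Module.finrank ℂ (fixedSpace (spMat h)) *
      (detFixedFy h g).eval (-(RatFunc.X ^ 2)⁻¹) = detFixedF h g := by
  obtain ⟨B, hB, -, hg⟩ := exists_form_restrictMat h
  obtain ⟨hiso, hdet⟩ := hg g
  have hX : (RatFunc.X : RatFunc ℂ) ≠ 0 := RatFunc.X_ne_zero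
  have key := det_one_sub_smul_eq_pow_mul
    (B := B.map (algebraMap ℂ (RatFunc ℂ)))
    (M := (restrictMat h g).map (algebraMap ℂ (RatFunc ℂ)))
    (by
      rw [← RingHom.mapMatrix_apply, ← RingHom.map_det]
      simpa using hB)
    (by rw [← transpose_map, ← Matrix.map_mul, ← Matrix.map_mul, hiso])
    (by rw [← RingHom.mapMatrix_apply, ← RingHom.map_det, hdet, map_one])
    (by simpa using even_finrank_fixedSpace h) hX
  rw [Fintype.card_fin] at key
  have hcoef : (RatFunc.X : RatFunc ℂ) * -(RatFunc.X ^ 2)⁻¹ = -RatFunc.X⁻¹ := by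
    field_simp
  rw [eval_detFixedFy, hcoef, neg_smul, ← sub_eq_add_neg, ← key, detFixedF]

end symplectic

theorem sum_card_centralizer (G : Type*) [Group G] [Fintype G] :
    ∑ h : G, Fintype.card ↥(Subgroup.centralizer ({h} : Set G)) =
      Nat.card (ConjClasses G) * Fintype.card G := by
  rw [← Nat.card_eq_fintype_card (α := G), ← card_comm_eq_card_conjClasses_mul_card,
    ← Fintype.card_sigma, ← Nat.card_eq_fintype_card]
  refine Nat.card_congr
    { toFun := fun p => ⟨(p.1, p.2), Subgroup.mem_centralizer_iff.mp p.2.2 p.1 rfl⟩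
      invFun := fun p => ⟨p.1.1, p.1.2, Subgroup.mem_centralizer_iff.mpr ?_⟩
      left_inv := fun p => rfl
      right_inv := fun p => rfl }
  rintro _ rfl
  exact p.2

/-- If every summand of `H̃_G` evaluates to `a` at `y`, then `H̃_G` evaluates to `a·c`. -/
theorem eval_Htilde {n : ℕ} {G : Subgroup ↥(Matrix.symplecticGroup (Fin n) ℂ)} [Fintype G]
    {y a : RatFunc ℂ}
    (ha : ∀ (h : G) (g : ↥(Subgroup.centralizer ({h} : Set G))),
      (-y) ^ spAge h * ((detFixedF h g)⁻¹ * (detFixedFy h g).eval y) = a) :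
    (Htilde n G).eval y = a * (Nat.card (ConjClasses G) : RatFunc ℂ) := by
  have hG : (Fintype.card G : RatFunc ℂ) ≠ 0 := Nat.cast_ne_zero.mpr Fintype.card_ne_zero
  have hsum : ∑ h : G, ∑ _g : ↥(Subgroup.centralizer ({h} : Set G)), a =
      (Nat.card (ConjClasses G) * Fintype.card G : RatFunc ℂ) * a := by
    simp only [Finset.sum_const, Finset.card_univ, nsmul_eq_mul]
    rw [← Finset.sum_mul, ← Nat.cast_sum, sum_card_centralizer, Nat.cast_mul]
  simp only [Htilde, Polynomial.eval_mul, Polynomial.eval_C, Polynomial.eval_finsetSum,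
    Polynomial.eval_pow, Polynomial.eval_neg, Polynomial.eval_X, Finset.mul_sum]
  simp only [← Finset.mul_sum, ha, hsum]
  field_simp

/-- For a finite subgroup `G ⊆ Sp(2n, ℂ)`, `n ≥ 1`, the polynomial
`(y + 1)·(T²·y + 1)` divides `H̃_G − (−y)^n·c` in `F[y]`, where `c` is the number of
conjugacy classes of `G`. -/
theorem crepant_divisibility
    (n : ℕ) (hn : 1 ≤ n)
    (G : Subgroup ↥(Matrix.symplecticGroup (Fin n) ℂ)) [Fintype G] :
    ((Polynomial.X + 1) * (Polynomial.C ((RatFunc.X : RatFunc ℂ) ^ 2) * Polynomial.X + 1)) ∣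
      (Htilde n G -
        (-Polynomial.X) ^ n * (Nat.card (ConjClasses G) : Polynomial (RatFunc ℂ))) := by
  set T : RatFunc ℂ := RatFunc.X with hT
  have hT0 : T ≠ 0 := RatFunc.X_ne_zero
  have hT1 : T ^ 2 - 1 ≠ 0 := by
    have hp : (Polynomial.X ^ 2 - 1 : Polynomial ℂ) ≠ 0 := by
      simpa using Polynomial.X_pow_sub_C_ne_zero two_pos (1 : ℂ)
    have h := (FaithfulSMul.algebraMap_eq_zero_iff (Polynomial ℂ) (RatFunc ℂ)).not.mpr hp
    simpa [RatFunc.algebraMap_X] using h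
  refine IsCoprime.mul_dvd ?_ ?_ ?_
  · refine ⟨Polynomial.C (T ^ 2 - 1)⁻¹ * Polynomial.C (T ^ 2), -Polynomial.C (T ^ 2 - 1)⁻¹, ?_⟩
    have hC : Polynomial.C (T ^ 2 - 1)⁻¹ * (Polynomial.C (T ^ 2) - 1) = 1 := by
      rw [← Polynomial.C_1, ← Polynomial.C_sub, ← Polynomial.C_mul, inv_mul_cancel₀ hT1]
    linear_combination hC
  · rw [← sub_neg_eq_add, ← Polynomial.C_1, ← Polynomial.C_neg, Polynomial.dvd_iff_isRoot,
      Polynomial.IsRoot, Polynomial.eval_sub, eval_Htilde (a := 1)]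
    · simp
    · intro h g
      rw [eval_neg_one_detFixedFy, inv_mul_cancel₀ (detFixedF_ne_zero h g), neg_neg, one_pow,
        one_mul]
  · have hfactor : Polynomial.C (T ^ 2) * Polynomial.X + 1 =
        Polynomial.C (T ^ 2) * (Polynomial.X - Polynomial.C (-(T ^ 2)⁻¹)) := by
      rw [mul_sub, ← Polynomial.C_mul, mul_neg, mul_inv_cancel₀ (pow_ne_zero 2 hT0)]
      simp
    have hunit : IsUnit (Polynomial.C (T ^ 2)) :=
      Polynomial.isUnit_C.mpr (pow_ne_zero 2 hT0).isUnit
    rw [hfactor, hunit.mul_left_dvd, Polynomial.dvd_iff_isRoot, Polynomial.IsRoot,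
      Polynomial.eval_sub, eval_Htilde (a := ((T ^ 2)⁻¹) ^ n)]
    · simp
    · intro h g
      have hd := detFixedF_ne_zero h g
      have hev := eval_neg_inv_sq_detFixedFy h g
      have hage := two_mul_spAge_add_finrank h
      rw [← hT] at hev
      rw [← hev] at hd ⊢
      have hE := right_ne_zero_of_mul hd
      rw [neg_neg, mul_inv, mul_assoc, inv_mul_cancel₀ hE, mul_one, inv_pow, inv_pow, ← mul_inv,
        ← pow_mul, ← pow_mul, ← pow_add, hage]

end
end

section
/- Let n ≥ 1 and let G be a finite subgroup of Sp(2n, ℂ). Then there exist r ∈ ℕ, positive integers k₁, …, k_r, and a polynomial P in two variables over ℝ such that H_G = P(y, T) / ∏_{i=1}^{r} (1 − T^{k_i}) in K, and every coefficient of the two-variable real polynomial P(−1−δ, 1+S) obtained by the substitution y := −1−δ, T := 1+S is nonnegative. -/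
open scoped BigOperators

set_option synthInstance.maxHeartbeats 1000000

/-- `H_G := |G|⁻¹ · ∑_{g ∈ G} det(1 + y·T·g) / det(1 − T·g) ∈ K` for a finite
subgroup `G` of the symplectic group `Sp(2n, ℂ)`. -/
noncomputable def HclassSp (n : ℕ)
    (G : Subgroup ↥(Matrix.symplecticGroup (Fin n) ℂ)) [Fintype G] : MolienK :=
  (Fintype.card G : MolienK)⁻¹ *
    ∑ g : G, Matrix.det
        ((1 : Matrix (Fin n ⊕ Fin n) (Fin n ⊕ Fin n) MolienK) + (molienY * molienT) •
          (((g : ↥(Matrix.symplecticGroup (Fin n) ℂ)) :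
            Matrix (Fin n ⊕ Fin n) (Fin n ⊕ Fin n) ℂ).map (algebraMap ℂ MolienK))) /
      Matrix.det
        ((1 : Matrix (Fin n ⊕ Fin n) (Fin n ⊕ Fin n) MolienK) - molienT •
          (((g : ↥(Matrix.symplecticGroup (Fin n) ℂ)) :
            Matrix (Fin n ⊕ Fin n) (Fin n ⊕ Fin n) ℂ).map (algebraMap ℂ MolienK)))

/-- For a symplectic matrix the characteristic polynomial is self-reciprocal. -/
theorem Matrix.charpolyRev_eq_charpoly_of_mem_symplecticGroup {l : Type*} [Fintype l]
    [DecidableEq l] {A : Matrix (l ⊕ l) (l ⊕ l) ℂ} (hA : A ∈ Matrix.symplecticGroup l ℂ) :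
    A.charpolyRev = A.charpoly := by
  have hdet : A.det = 1 := SymplecticGroup.det_eq_one hA
  have hunit : IsUnit A := (Matrix.isUnit_iff_isUnit_det A).2 (by simp [hdet])
  have hinv := Matrix.charpoly_inv A hunit
  rw [hdet, Fintype.card_sum, Even.neg_one_pow ⟨_, rfl⟩] at hinv
  simp only [Ring.inverse_one, map_one, one_mul] at hinv
  have hJ : IsUnit (Matrix.J l ℂ) :=
    (Matrix.isUnit_iff_isUnit_det _).2 (Matrix.isUnit_det_J l ℂ)
  obtain ⟨u, hu⟩ := hJ
  have huinv : ((u⁻¹ : (Matrix (l ⊕ l) (l ⊕ l) ℂ)ˣ) : Matrix (l ⊕ l) (l ⊕ l) ℂ) =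
      -Matrix.J l ℂ := by
    rw [Matrix.coe_units_inv, hu, Matrix.J_inv]
  have hconj : A⁻¹ = (u⁻¹ : (Matrix (l ⊕ l) (l ⊕ l) ℂ)ˣ).val * A.transpose * u.val := by
    rw [huinv, hu]
    exact SymplecticGroup.inv_eq_symplectic_inv A hA
  rw [← hinv, hconj, Matrix.coe_units_inv, Matrix.charpoly_units_conj', Matrix.charpoly_transpose]

theorem Matrix.aeval_charpolyRev {m R L : Type*} [Fintype m] [DecidableEq m] [CommRing R]
    [CommRing L] [Algebra R L] (A : Matrix m m R) (t : L) :
    Polynomial.aeval t A.charpolyRev = (1 - t • A.map (algebraMap R L)).det := by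
  rw [Matrix.charpolyRev, AlgHom.map_det]
  congr 1
  ext i j
  by_cases h : i = j <;> simp [h] <;> ring

theorem Matrix.det_one_sub_smul_eq_prod_roots {l : Type*} [Fintype l] [DecidableEq l]
    {L : Type*} [CommRing L] [Algebra ℂ L]
    {A : Matrix (l ⊕ l) (l ⊕ l) ℂ} (hA : A ∈ Matrix.symplecticGroup l ℂ) (t : L) :
    (1 - t • A.map (algebraMap ℂ L)).det =
      (A.charpoly.roots.map fun z => t - algebraMap ℂ L z).prod := by
  rw [← Matrix.aeval_charpolyRev, Matrix.charpolyRev_eq_charpoly_of_mem_symplecticGroup hA]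
  conv_lhs => rw [(IsAlgClosed.splits A.charpoly).eq_prod_roots_of_monic A.charpoly_monic]
  rw [map_multiset_prod, Multiset.map_map]
  simp

open Polynomial in
theorem Polynomial.reverse_multiset_prod {R ι : Type*} [CommRing R] [IsDomain R]
    (s : Multiset ι) (f : ι → R[X]) :
    (s.map f).prod.reverse = (s.map fun i => (f i).reverse).prod := by
  induction s using Multiset.induction with
  | empty => simpa using Polynomial.reverse_C (1 : R)
  | cons a s ih => simp [Polynomial.reverse_mul_of_domain, ih]

theorem Complex.mul_conj_eq_one_of_pow_eq_one {z : ℂ} {N : ℕ} (hN : N ≠ 0) (hz : z ^ N = 1) :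
    z * (starRingEnd ℂ) z = 1 := by
  rw [Complex.mul_conj, Complex.normSq_eq_norm_sq, Complex.norm_eq_one_of_pow_eq_one hz hN]
  simp

open Polynomial in
/-- The eigenvalues of a symplectic matrix of finite order are closed under conjugation. -/
theorem Matrix.map_conj_roots_charpoly {l : Type*} [Fintype l] [DecidableEq l]
    {A : Matrix (l ⊕ l) (l ⊕ l) ℂ} (hA : A ∈ Matrix.symplecticGroup l ℂ)
    {N : ℕ} (hN : N ≠ 0) (hroots : ∀ z ∈ A.charpoly.roots, z ^ N = 1) :
    A.charpoly.roots.map (starRingEnd ℂ) = A.charpoly.roots := by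
  have hprod := (IsAlgClosed.splits A.charpoly).eq_prod_roots_of_monic A.charpoly_monic
  have hrev : A.charpoly = (A.charpoly.roots.map fun z => (X - C z).reverse).prod := by
    rw [← Polynomial.reverse_multiset_prod, ← hprod, Matrix.reverse_charpoly,
      Matrix.charpolyRev_eq_charpoly_of_mem_symplecticGroup hA]
  have hfactor : ∀ z ∈ A.charpoly.roots,
      (X - C z).reverse = C (-z) * (X - C (starRingEnd ℂ z)) := by
    intro z hz
    have h1 : (X - C z : ℂ[X]).reverse = 1 - C z * X := by
      have h := Polynomial.reverse_add_C (X : ℂ[X]) (-z)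
      simp only [map_neg, ← sub_eq_add_neg] at h
      rw [h, ← one_mul (X : ℂ[X]), Polynomial.reverse_mul_X, ← C_1, Polynomial.reverse_C]
      simp [sub_eq_add_neg]
    have h2 : C z * C (starRingEnd ℂ z) = (1 : ℂ[X]) := by
      rw [← C_mul, Complex.mul_conj_eq_one_of_pow_eq_one hN (hroots z hz), C_1]
    rw [h1, C_neg]
    linear_combination -h2
  have hC : (A.charpoly.roots.map fun z => C (-z)).prod =
      C (A.charpoly.roots.map fun z => -z).prod := by
    rw [map_multiset_prod, Multiset.map_map]
    rfl
  have hX : (A.charpoly.roots.map fun z => X - C (starRingEnd ℂ z)) =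
      (A.charpoly.roots.map (starRingEnd ℂ)).map fun z => X - C z := by
    rw [Multiset.map_map]
    rfl
  rw [Multiset.map_congr rfl hfactor, Multiset.prod_map_mul,
    hC, hX] at hrev
  have hne : (A.charpoly.roots.map fun z => -z).prod ≠ 0 := by
    intro h0
    rw [h0, C_0, zero_mul] at hrev
    exact A.charpoly_monic.ne_zero hrev
  have := congrArg Polynomial.roots hrev
  rw [Polynomial.roots_C_mul _ hne, Polynomial.roots_multiset_prod_X_sub_C] at this
  exact this.symm

theorem Matrix.pow_eq_one_of_mem_roots_charpoly {m : Type*} [Fintype m] [DecidableEq m]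
    {A : Matrix m m ℂ} {N : ℕ} (hA : A ^ N = 1) {z : ℂ} (hz : z ∈ A.charpoly.roots) :
    z ^ N = 1 := by
  have h1 : z ∈ spectrum ℂ A :=
    Matrix.mem_spectrum_of_isRoot_charpoly (Polynomial.isRoot_of_mem_roots hz)
  have h2 := spectrum.pow_mem_pow A N h1
  rw [hA] at h2
  rcases subsingleton_or_nontrivial (Matrix m m ℂ) with h | h
  · simp [spectrum.of_subsingleton] at h1
  · simpa [spectrum.one_eq] using h2

/-- A product over a conjugation-stable multiset lies in a submonoid as soon as the products over
conjugate pairs and the factors at real points do. -/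
theorem Multiset.prod_map_mem_of_map_conj_eq {M : Type*} [CommMonoid M] (S : Submonoid M)
    (f : ℂ → M) (s : Multiset ℂ) (hs : s.map (starRingEnd ℂ) = s)
    (hpair : ∀ z ∈ s, f z * f (starRingEnd ℂ z) ∈ S)
    (hreal : ∀ z ∈ s, starRingEnd ℂ z = z → f z ∈ S) : (s.map f).prod ∈ S := by
  induction s using Multiset.strongInductionOn with
  | ih s ih =>
    rcases s.empty_or_exists_mem with rfl | ⟨a, ha⟩
    · simp
    obtain ⟨t, rfl⟩ := Multiset.exists_cons_of_mem ha
    by_cases hreal_a : starRingEnd ℂ a = a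
    · have ht : t.map (starRingEnd ℂ) = t := by
        rw [Multiset.map_cons, hreal_a] at hs
        exact (Multiset.cons_inj_right a).1 hs
      rw [Multiset.map_cons, Multiset.prod_cons]
      exact S.mul_mem (hreal a ha hreal_a) (ih t (Multiset.lt_cons_self t a) ht
        (fun z hz => hpair z (Multiset.mem_cons_of_mem hz))
        fun z hz => hreal z (Multiset.mem_cons_of_mem hz))
    · have hmem : starRingEnd ℂ a ∈ t := by
        have : starRingEnd ℂ a ∈ a ::ₘ t := by
          rw [← hs]
          exact Multiset.mem_map_of_mem _ ha
        exact (Multiset.mem_cons.1 this).resolve_left hreal_a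
      obtain ⟨u, rfl⟩ := Multiset.exists_cons_of_mem hmem
      have hu : u.map (starRingEnd ℂ) = u := by
        rw [Multiset.map_cons, Multiset.map_cons, Complex.conj_conj, Multiset.cons_swap] at hs
        exact (Multiset.cons_inj_right _).1 ((Multiset.cons_inj_right _).1 hs)
      rw [Multiset.map_cons, Multiset.prod_cons, Multiset.map_cons, Multiset.prod_cons,
        ← mul_assoc]
      exact S.mul_mem (hpair a ha) (ih u
        ((Multiset.lt_cons_self u _).trans (Multiset.lt_cons_self _ a)) hu
        (fun z hz => hpair z (Multiset.mem_cons_of_mem (Multiset.mem_cons_of_mem hz)))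
        fun z hz => hreal z (Multiset.mem_cons_of_mem (Multiset.mem_cons_of_mem hz)))

/-- Complex polynomials in `δ = X 0` and `S = X 1` with nonnegative real coefficients. -/
noncomputable def nonnegPoly : Subsemiring (MvPolynomial (Fin 2) ℂ) :=
  (MvPolynomial.map (algebraMap NNReal ℂ)).rangeS

theorem X_mem_nonnegPoly (i : Fin 2) : MvPolynomial.X i ∈ nonnegPoly :=
  ⟨MvPolynomial.X i, MvPolynomial.map_X _ i⟩

theorem C_ofReal_mem_nonnegPoly {r : ℝ} (hr : 0 ≤ r) :
    (MvPolynomial.C (r : ℂ) : MvPolynomial (Fin 2) ℂ) ∈ nonnegPoly :=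
  ⟨MvPolynomial.C (NNReal.mk r hr), by rw [MvPolynomial.map_C]; rfl⟩

theorem one_add_X_mem_nonnegPoly (i : Fin 2) : 1 + MvPolynomial.X i ∈ nonnegPoly :=
  add_mem (one_mem _) (X_mem_nonnegPoly i)

/-- The linear form `T - z`, written in the variable `S = T - 1`. -/
noncomputable def shiftedLinear (z : ℂ) : MvPolynomial (Fin 2) ℂ :=
  1 + MvPolynomial.X 1 - MvPolynomial.C z

theorem shiftedLinear_mem_of_conj_eq {z : ℂ} (hz : z.re ≤ 1) (hconj : starRingEnd ℂ z = z) :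
    shiftedLinear z ∈ nonnegPoly := by
  have h : shiftedLinear z = MvPolynomial.C ((1 - z.re : ℝ) : ℂ) + MvPolynomial.X 1 := by
    rw [Complex.ofReal_sub, Complex.conj_eq_iff_re.1 hconj, Complex.ofReal_one, map_sub,
      MvPolynomial.C_1, shiftedLinear]
    ring
  rw [h]
  exact add_mem (C_ofReal_mem_nonnegPoly (by linarith)) (X_mem_nonnegPoly 1)

theorem C_add_C_conj (z : ℂ) :
    (MvPolynomial.C z + MvPolynomial.C (starRingEnd ℂ z) : MvPolynomial (Fin 2) ℂ) =
      MvPolynomial.C ((2 * z.re : ℝ) : ℂ) := by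
  rw [← map_add, Complex.add_conj]

theorem shiftedLinear_add_conj_mem {z : ℂ} (hz : z.re ≤ 1) :
    shiftedLinear z + shiftedLinear (starRingEnd ℂ z) ∈ nonnegPoly := by
  have h : shiftedLinear z + shiftedLinear (starRingEnd ℂ z) =
      MvPolynomial.C ((2 - 2 * z.re : ℝ) : ℂ) + MvPolynomial.X 1 + MvPolynomial.X 1 := by
    have h1 := C_add_C_conj z
    rw [Complex.ofReal_sub, map_sub, ← h1]
    simp only [shiftedLinear, Complex.ofReal_ofNat, map_ofNat]
    ring
  rw [h]
  exact add_mem (add_mem (C_ofReal_mem_nonnegPoly (by linarith)) (X_mem_nonnegPoly 1))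
    (X_mem_nonnegPoly 1)

theorem shiftedLinear_mul_conj_mem {z : ℂ} (hz : z.re ≤ 1) :
    shiftedLinear z * shiftedLinear (starRingEnd ℂ z) ∈ nonnegPoly := by
  have h : shiftedLinear z * shiftedLinear (starRingEnd ℂ z) =
      MvPolynomial.X 1 * MvPolynomial.X 1 +
        MvPolynomial.C ((2 - 2 * z.re : ℝ) : ℂ) * MvPolynomial.X 1 +
        MvPolynomial.C ((Complex.normSq (1 - z) : ℝ) : ℂ) := by
    have h1 := C_add_C_conj z
    rw [Complex.ofReal_sub, map_sub, ← h1, Complex.normSq_eq_conj_mul_self]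
    simp only [shiftedLinear, Complex.ofReal_ofNat, map_ofNat, map_mul, map_sub, map_one]
    ring
  rw [h]
  exact add_mem (add_mem (mul_mem (X_mem_nonnegPoly 1) (X_mem_nonnegPoly 1))
    (mul_mem (C_ofReal_mem_nonnegPoly (by linarith)) (X_mem_nonnegPoly 1)))
    (C_ofReal_mem_nonnegPoly (Complex.normSq_nonneg _))

/-- The linear form `-y * T - z`, written in the variables `δ = -1 - y` and `S = T - 1`. -/
noncomputable def shiftedNumerator (z : ℂ) : MvPolynomial (Fin 2) ℂ :=
  shiftedLinear z + MvPolynomial.X 0 * (1 + MvPolynomial.X 1)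

/-- The polynomial `(-y * T - z) * (T ^ N - 1) / (T - z)`, for an `N`-th root of unity `z`, written
in the variables `δ = -1 - y` and `S = T - 1`. -/
noncomputable def shiftedFactor (N : ℕ) (z : ℂ) : MvPolynomial (Fin 2) ℂ :=
  shiftedNumerator z *
    (((Polynomial.nthRootsFinset N (1 : ℂ)).erase z).val.map shiftedLinear).prod

theorem Complex.re_le_one_of_pow_eq_one {z : ℂ} {N : ℕ} (hN : N ≠ 0) (hz : z ^ N = 1) :
    z.re ≤ 1 :=
  (Complex.re_le_norm z).trans (Complex.norm_eq_one_of_pow_eq_one hz hN).le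

theorem map_conj_erase_nthRootsFinset {N : ℕ} (hN : 0 < N) (z : ℂ) :
    ((Polynomial.nthRootsFinset N (1 : ℂ)).erase z).val.map (starRingEnd ℂ) =
      ((Polynomial.nthRootsFinset N (1 : ℂ)).erase (starRingEnd ℂ z)).val := by
  have hinj : Function.Injective (starRingEnd ℂ) := (starRingEnd ℂ).injective
  rw [← Finset.image_val_of_injOn hinj.injOn]
  congr 1
  ext w
  simp only [Finset.mem_image, Finset.mem_erase, Polynomial.mem_nthRootsFinset hN]
  constructor
  · rintro ⟨v, ⟨hv, hv1⟩, rfl⟩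
    exact ⟨fun h => hv (hinj h), by rw [← map_pow, hv1, map_one]⟩
  · rintro ⟨hw, hw1⟩
    refine ⟨starRingEnd ℂ w, ⟨?_, by rw [← map_pow, hw1, map_one]⟩, Complex.conj_conj w⟩
    rintro rfl
    exact hw (Complex.conj_conj w).symm

theorem re_le_one_of_mem_erase_nthRootsFinset {N : ℕ} (hN : 0 < N) {z w : ℂ}
    (hw : w ∈ ((Polynomial.nthRootsFinset N (1 : ℂ)).erase z).val) : w.re ≤ 1 :=
  Complex.re_le_one_of_pow_eq_one hN.ne'
    ((Polynomial.mem_nthRootsFinset hN _).1 (Finset.mem_of_mem_erase hw))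

theorem shiftedFactor_mem_of_conj_eq {N : ℕ} (hN : 0 < N) {z : ℂ} (hz : z ^ N = 1)
    (hconj : starRingEnd ℂ z = z) : shiftedFactor N z ∈ nonnegPoly := by
  have hre := Complex.re_le_one_of_pow_eq_one hN.ne' hz
  refine mul_mem (add_mem (shiftedLinear_mem_of_conj_eq hre hconj)
    (mul_mem (X_mem_nonnegPoly 0) (one_add_X_mem_nonnegPoly 1))) ?_
  refine Multiset.prod_map_mem_of_map_conj_eq nonnegPoly.toSubmonoid shiftedLinear _ ?_ ?_ ?_
  · rw [map_conj_erase_nthRootsFinset hN, hconj]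
  · exact fun w hw =>
      shiftedLinear_mul_conj_mem (re_le_one_of_mem_erase_nthRootsFinset hN hw)
  · exact fun w hw =>
      shiftedLinear_mem_of_conj_eq (re_le_one_of_mem_erase_nthRootsFinset hN hw)

theorem shiftedFactor_mul_conj_mem {N : ℕ} (hN : 0 < N) {z : ℂ} (hz : z ^ N = 1) :
    shiftedFactor N z * shiftedFactor N (starRingEnd ℂ z) ∈ nonnegPoly := by
  have hre := Complex.re_le_one_of_pow_eq_one hN.ne' hz
  have hX : MvPolynomial.X 0 * (1 + MvPolynomial.X 1) ∈ nonnegPoly :=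
    mul_mem (X_mem_nonnegPoly 0) (one_add_X_mem_nonnegPoly 1)
  rw [shiftedFactor, shiftedFactor, mul_mul_mul_comm]
  refine mul_mem ?_ ?_
  · have h : shiftedNumerator z * shiftedNumerator (starRingEnd ℂ z) =
        shiftedLinear z * shiftedLinear (starRingEnd ℂ z) +
        MvPolynomial.X 0 * (1 + MvPolynomial.X 1) *
          (shiftedLinear z + shiftedLinear (starRingEnd ℂ z)) +
        MvPolynomial.X 0 * (1 + MvPolynomial.X 1) *
          (MvPolynomial.X 0 * (1 + MvPolynomial.X 1)) := by
      simp only [shiftedNumerator]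
      ring
    rw [h]
    exact add_mem (add_mem (shiftedLinear_mul_conj_mem hre)
      (mul_mem hX (shiftedLinear_add_conj_mem hre))) (mul_mem hX hX)
  · rw [← map_conj_erase_nthRootsFinset hN, Multiset.map_map, ← Multiset.prod_map_mul]
    refine multiset_prod_mem _ fun p hp => ?_
    obtain ⟨w, hw, rfl⟩ := Multiset.mem_map.1 hp
    exact shiftedLinear_mul_conj_mem (re_le_one_of_mem_erase_nthRootsFinset hN hw)

theorem prod_shiftedFactor_mem {N : ℕ} (hN : 0 < N) {s : Multiset ℂ}
    (hs : s.map (starRingEnd ℂ) = s) (hroots : ∀ z ∈ s, z ^ N = 1) :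
    (s.map (shiftedFactor N)).prod ∈ nonnegPoly :=
  Multiset.prod_map_mem_of_map_conj_eq nonnegPoly.toSubmonoid (shiftedFactor N) s hs
    (fun z hz => shiftedFactor_mul_conj_mem hN (hroots z hz))
    fun z hz => shiftedFactor_mem_of_conj_eq hN (hroots z hz)

/-- The substitution `δ = -1 - y`, `S = T - 1` into `K`. -/
noncomputable def unshift : MvPolynomial (Fin 2) ℂ →ₐ[ℂ] MolienK :=
  MvPolynomial.aeval ![-1 - molienY, molienT - 1]

theorem unshift_shiftedLinear (z : ℂ) :
    unshift (shiftedLinear z) = molienT - algebraMap ℂ MolienK z := by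
  simp [unshift, shiftedLinear, ← MvPolynomial.algebraMap_eq]

theorem unshift_shiftedNumerator (z : ℂ) :
    unshift (shiftedNumerator z) = -(molienY * molienT) - algebraMap ℂ MolienK z := by
  rw [shiftedNumerator, map_add, unshift_shiftedLinear]
  simp only [unshift, map_mul, map_add, map_one, MvPolynomial.aeval_X, Matrix.cons_val_zero,
    Matrix.cons_val_one]
  ring

theorem molienT_pow_sub_one_ne_zero {N : ℕ} (hN : 0 < N) : molienT ^ N - 1 ≠ 0 := by
  intro h
  have h1 : algebraMap (MvPolynomial (Fin 2) ℂ) MolienK (MvPolynomial.X 1 ^ N - 1) = 0 := by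
    simpa using h
  rw [map_eq_zero_iff _ (IsFractionRing.injective (MvPolynomial (Fin 2) ℂ) MolienK)] at h1
  simpa [hN.ne'] using congrArg (MvPolynomial.eval 0) h1

theorem molienT_pow_sub_one_eq_mul {N : ℕ} (hN : 0 < N) {z : ℂ} (hz : z ^ N = 1) :
    molienT ^ N - 1 = (molienT - algebraMap ℂ MolienK z) *
      unshift (((Polynomial.nthRootsFinset N (1 : ℂ)).erase z).val.map shiftedLinear).prod := by
  have hprod := congrArg (Polynomial.aeval molienT)
    (Polynomial.X_pow_sub_one_eq_prod hN (Complex.isPrimitiveRoot_exp N hN.ne'))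
  rw [← Finset.mul_prod_erase _ _ ((Polynomial.mem_nthRootsFinset hN _).2 hz)] at hprod
  simp only [map_sub, map_pow, map_one, map_mul, map_prod, Polynomial.aeval_X,
    Polynomial.aeval_C] at hprod
  rw [hprod]
  congr 1
  rw [map_multiset_prod, Multiset.map_map]
  simp only [Function.comp_def, unshift_shiftedLinear]
  rfl

theorem div_eq_unshift_shiftedFactor_div {N : ℕ} (hN : 0 < N) {z : ℂ} (hz : z ^ N = 1) :
    (-(molienY * molienT) - algebraMap ℂ MolienK z) / (molienT - algebraMap ℂ MolienK z) =
      unshift (shiftedFactor N z) / (molienT ^ N - 1) := by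
  have hne := molienT_pow_sub_one_ne_zero hN
  rw [molienT_pow_sub_one_eq_mul hN hz] at hne ⊢
  rw [shiftedFactor, map_mul, unshift_shiftedNumerator,
    mul_div_mul_right _ _ (right_ne_zero_of_mul hne)]

theorem det_div_det_eq_unshift_div {n N : ℕ} (hN : 0 < N)
    {A : Matrix (Fin n ⊕ Fin n) (Fin n ⊕ Fin n) ℂ} (hA : A ∈ Matrix.symplecticGroup (Fin n) ℂ)
    (hpow : A ^ N = 1) :
    (1 + (molienY * molienT) • A.map (algebraMap ℂ MolienK)).det /
        (1 - molienT • A.map (algebraMap ℂ MolienK)).det =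
      unshift (A.charpoly.roots.map (shiftedFactor N)).prod /
        (1 - molienT ^ N) ^ (n + n) := by
  have hcard : A.charpoly.roots.card = n + n := by
    rw [← (IsAlgClosed.splits A.charpoly).natDegree_eq_card_roots,
      Matrix.charpoly_natDegree_eq_dim]
    simp
  have hneg : (1 : Matrix (Fin n ⊕ Fin n) (Fin n ⊕ Fin n) MolienK) +
      (molienY * molienT) • A.map (algebraMap ℂ MolienK) =
      1 - (-(molienY * molienT)) • A.map (algebraMap ℂ MolienK) := by
    rw [neg_smul, sub_neg_eq_add]
  rw [hneg, Matrix.det_one_sub_smul_eq_prod_roots hA, Matrix.det_one_sub_smul_eq_prod_roots hA,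
    ← Multiset.prod_map_div, Multiset.map_congr rfl fun z hz =>
      div_eq_unshift_shiftedFactor_div hN (Matrix.pow_eq_one_of_mem_roots_charpoly hpow hz),
    Multiset.prod_map_div, map_multiset_prod, Multiset.map_map, Multiset.map_const',
    Multiset.prod_replicate, hcard, ← Even.neg_pow ⟨n, rfl⟩ (molienT ^ N - 1), neg_sub]
  rfl

/-- The image under `unshift` of a polynomial with nonnegative coefficients comes from a real
polynomial in `y` and `T` that becomes nonnegative after the substitution `y = -1 - δ`,
`T = 1 + S`. -/
theorem exists_real_polynomial_of_mem_nonnegPoly {Q : MvPolynomial (Fin 2) ℂ}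
    (hQ : Q ∈ nonnegPoly) :
    ∃ P : MvPolynomial (Fin 2) ℝ,
      MvPolynomial.aeval ![molienY, molienT] (MvPolynomial.map (algebraMap ℝ ℂ) P) = unshift Q ∧
      ∀ m : Fin 2 →₀ ℕ,
        0 ≤ MvPolynomial.coeff m
          (MvPolynomial.aeval
            ![-1 - MvPolynomial.X 0, 1 + MvPolynomial.X 1] P : MvPolynomial (Fin 2) ℝ) := by
  obtain ⟨R, rfl⟩ := hQ
  let R' : MvPolynomial (Fin 2) ℝ := MvPolynomial.map (algebraMap NNReal ℝ) R
  let ψ : MvPolynomial (Fin 2) ℝ →ₐ[ℝ] MvPolynomial (Fin 2) ℝ :=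
    MvPolynomial.aeval ![-1 - MvPolynomial.X 0, MvPolynomial.X 1 - 1]
  refine ⟨ψ R', ?_, fun m => ?_⟩
  · have hR : MvPolynomial.map (algebraMap NNReal ℂ) R =
        MvPolynomial.map (algebraMap ℝ ℂ) R' := by
      rw [MvPolynomial.map_map]
      rfl
    have hhom : ((MvPolynomial.aeval ![molienY, molienT] :
          MvPolynomial (Fin 2) ℂ →ₐ[ℂ] MolienK).toRingHom.comp
            (MvPolynomial.map (algebraMap ℝ ℂ))).comp ψ.toRingHom =
        unshift.toRingHom.comp (MvPolynomial.map (algebraMap ℝ ℂ)) := by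
      refine MvPolynomial.ringHom_ext (fun r => ?_) fun i => ?_
      · simp [ψ, unshift, ← MvPolynomial.algebraMap_eq]
      · fin_cases i <;> simp [ψ, unshift]
    rw [hR]
    exact RingHom.congr_fun hhom R'
  · have hhom : (MvPolynomial.aeval
          ![-1 - MvPolynomial.X 0, 1 + MvPolynomial.X 1] :
          MvPolynomial (Fin 2) ℝ →ₐ[ℝ] MvPolynomial (Fin 2) ℝ).comp ψ = AlgHom.id ℝ _ := by
      refine MvPolynomial.algHom_ext fun i => ?_
      fin_cases i <;> simp [ψ]
    have h := DFunLike.congr_fun hhom R'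
    rw [AlgHom.comp_apply, AlgHom.id_apply] at h
    rw [h, MvPolynomial.coeff_map]
    exact NNReal.coe_nonneg _

/-- For a finite subgroup `G ⊆ Sp(2n, ℂ)`, `n ≥ 1`, there exist `r ∈ ℕ`, positive
integers `k₁, …, k_r`, and a real polynomial `P` in two variables such that
`H_G = P(y, T)/∏ᵢ (1 − T^{kᵢ})` in `K` and every coefficient of `P(−1−δ, 1+S)` is
nonnegative. -/
theorem symplectic_positivity_cyclotomic_denominator
    (n : ℕ) (hn : 1 ≤ n)
    (G : Subgroup ↥(Matrix.symplecticGroup (Fin n) ℂ)) [Fintype G] :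
    ∃ (r : ℕ) (k : Fin r → ℕ) (P : MvPolynomial (Fin 2) ℝ),
      (∀ i : Fin r, 0 < k i) ∧
      HclassSp n G =
        MvPolynomial.aeval ![molienY, molienT] (MvPolynomial.map (algebraMap ℝ ℂ) P) /
          ∏ i : Fin r, (1 - molienT ^ (k i)) ∧
      (∀ m : Fin 2 →₀ ℕ,
        0 ≤ MvPolynomial.coeff m
          (MvPolynomial.aeval
            ![-1 - MvPolynomial.X 0, 1 + MvPolynomial.X 1] P : MvPolynomial (Fin 2) ℝ)) := by
  classical
  set N := Fintype.card G
  have hN : 0 < N := Fintype.card_pos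
  have hpow (g : G) : ((g : ↥(Matrix.symplecticGroup (Fin n) ℂ)) :
      Matrix (Fin n ⊕ Fin n) (Fin n ⊕ Fin n) ℂ) ^ N = 1 := by
    rw [← SubmonoidClass.coe_pow, ← Subgroup.coe_pow, pow_card_eq_one]
    rfl
  let Q (g : G) : MvPolynomial (Fin 2) ℂ :=
    (((g : ↥(Matrix.symplecticGroup (Fin n) ℂ)) :
      Matrix (Fin n ⊕ Fin n) (Fin n ⊕ Fin n) ℂ).charpoly.roots.map (shiftedFactor N)).prod
  have hQ (g : G) : Q g ∈ nonnegPoly := by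
    have hroots := fun z hz =>
      Matrix.pow_eq_one_of_mem_roots_charpoly (hpow g) (z := z) hz
    exact prod_shiftedFactor_mem hN
      (Matrix.map_conj_roots_charpoly (g : ↥(Matrix.symplecticGroup (Fin n) ℂ)).2
        hN.ne' hroots) hroots
  obtain ⟨P, hP, hcoeff⟩ := exists_real_polynomial_of_mem_nonnegPoly
    (mul_mem (C_ofReal_mem_nonnegPoly (r := (N : ℝ)⁻¹) (by positivity))
      (sum_mem fun g (_ : g ∈ Finset.univ) => hQ g))
  refine ⟨n + n, fun _ => N, P, fun _ => hN, ?_, hcoeff⟩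
  have hC : unshift (MvPolynomial.C (((N : ℝ)⁻¹ : ℝ) : ℂ)) = (N : MolienK)⁻¹ := by
    simp [unshift, ← MvPolynomial.algebraMap_eq]
  rw [hP, map_mul, hC, map_sum, Finset.prod_const, Finset.card_univ, Fintype.card_fin,
    mul_div_assoc, Finset.sum_div, HclassSp]
  congr 1
  exact Finset.sum_congr rfl fun g _ => det_div_det_eq_unshift_div hN
    (g : ↥(Matrix.symplecticGroup (Fin n) ℂ)).2 (hpow g)
end

section
/- (Chern–Schwartz–MacPherson limit formula.) Let G be a finite subgroup of GL(n, ℂ), n ≥ 1, and let t be a nonzero real number. For g ∈ G let d_g = dim_ℂ ker(g − 1), the dimension of the fixed subspace of g in ℂⁿ. Then the complex-valued function of a real variable δ given by δ ↦ |G|⁻¹ · Σ_{g ∈ G} det(1 − (1+δ)·e^{δt}·g) / det(1 − e^{δt}·g) (whose denominators det(1 − e^{δt}·g) are nonzero for all sufficiently small real δ ≠ 0) tends, as δ → 0 along nonzero real values (Filter.Tendsto along 𝓝[≠] 0), to the limit |G|⁻¹ · Σ_{g ∈ G} ((1+t)/t)^{d_g}. -/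
open scoped BigOperators Topology

open Polynomial in
/-- If a matrix satisfies `A ^ k = 1` with `k > 0`, then `det (1 - c A)` vanishes at `c = 1` to
order exactly the dimension of the fixed subspace of `A`. -/
theorem exists_det_one_sub_smul_eq_pow_mul {n : ℕ} (A : Matrix (Fin n) (Fin n) ℂ) {k : ℕ}
    (hk : 0 < k) (hA : A ^ k = 1) :
    ∃ F : ℂ → ℂ, ContinuousAt F 1 ∧ F 1 ≠ 0 ∧ ∀ c : ℂ, c ≠ 0 →
      (1 - c • A).det =
        (1 - c) ^ Module.finrank ℂ (LinearMap.ker (Matrix.toLin' (A - 1))) * F c := by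
  have hss : Module.End.IsSemisimple (Matrix.toLin' A) := by
    have hsep : (X ^ k - 1 : ℂ[X]).Separable := by
      simpa using separable_X_pow_sub_C (1 : ℂ) (by exact_mod_cast hk.ne') one_ne_zero
    refine Module.End.isSemisimple_of_squarefree_aeval_eq_zero hsep.squarefree ?_
    have h1 : (Matrix.toLin' A) ^ k = 1 := by
      rw [← Matrix.toLin'_pow, hA, Matrix.toLin'_one]; rfl
    simp [h1]
  have hd : Module.finrank ℂ (LinearMap.ker (Matrix.toLin' (A - 1))) =
      A.charpoly.rootMultiplicity 1 := by
    have h := LinearMap.finrank_maxGenEigenspace_eq (Matrix.toLin' A) 1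
    rw [hss.isFinitelySemisimple.maxGenEigenspace_eq_eigenspace, Module.End.eigenspace_def,
      Matrix.charpoly_toLin'] at h
    rw [← h, map_sub, Matrix.toLin'_one, one_smul]
    rfl
  obtain ⟨q, hq, hq1⟩ :=
    exists_eq_pow_rootMultiplicity_mul_and_not_dvd A.charpoly A.charpoly_monic.ne_zero 1
  rw [← hd] at hq
  set m := Module.finrank ℂ (LinearMap.ker (Matrix.toLin' (A - 1)))
  refine ⟨fun c => c ^ n * c⁻¹ ^ m * q.eval c⁻¹, ?_, ?_, fun c hc => ?_⟩
  · have hinv : ContinuousAt (fun c : ℂ => c⁻¹) 1 := continuousAt_inv₀ one_ne_zero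
    exact ((continuousAt_id.pow n).mul (hinv.pow m)).mul
      (q.continuous.continuousAt.comp hinv)
  · rw [dvd_iff_isRoot, IsRoot] at hq1
    simpa using hq1
  · have h1 : (1 - c • A) = c • (Matrix.scalar (Fin n) c⁻¹ - A) := by
      rw [smul_sub, Matrix.scalar_apply, ← Matrix.smul_one_eq_diagonal, smul_smul,
        mul_inv_cancel₀ hc, one_smul]
    have h2 : 1 - c = c * (c⁻¹ - 1) := by field_simp
    rw [h1, Matrix.det_smul, Fintype.card_fin, ← Matrix.eval_charpoly, hq, h2]
    simp only [eval_mul, eval_pow, eval_sub, eval_X, eval_C, mul_pow, inv_pow]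
    field_simp

/-- If `u` and `v` are differentiable at `0` with `u 0 = v 0 = 1` and `v' ≠ 0`, then
`(1 - u) / (1 - v)` tends to `u' / v'`. -/
theorem tendsto_one_sub_div_one_sub {u v : ℝ → ℝ} {u' v' : ℝ} (hu : HasDerivAt u u' 0)
    (hv : HasDerivAt v v' 0) (hu0 : u 0 = 1) (hv0 : v 0 = 1) (hv' : v' ≠ 0) :
    Filter.Tendsto (fun x => (1 - u x) / (1 - v x)) (𝓝[≠] 0) (𝓝 (u' / v')) := by
  refine ((hasDerivAt_iff_tendsto_slope.1 hu).div
    (hasDerivAt_iff_tendsto_slope.1 hv) hv').congr' ?_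
  filter_upwards [self_mem_nhdsWithin] with x hx
  have hx : x ≠ 0 := hx
  simp only [Pi.div_apply, slope_def_field, hu0, hv0, sub_zero]
  rw [div_div_div_cancel_right₀ hx, ← neg_sub, ← neg_sub 1 (v x), neg_div_neg_eq]

/-- The limit formula for one matrix of finite order. -/
theorem tendsto_det_one_sub_smul_div {n : ℕ} (A : Matrix (Fin n) (Fin n) ℂ) {k : ℕ}
    (hk : 0 < k) (hA : A ^ k = 1) {t : ℝ} (ht : t ≠ 0) :
    (∀ᶠ δ : ℝ in 𝓝[≠] 0, (1 - ((Real.exp (δ * t) : ℝ) : ℂ) • A).det ≠ 0) ∧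
    Filter.Tendsto (fun δ : ℝ => (1 - (((1 + δ) * Real.exp (δ * t) : ℝ) : ℂ) • A).det /
        (1 - ((Real.exp (δ * t) : ℝ) : ℂ) • A).det) (𝓝[≠] 0)
      (𝓝 ((((1 + t) / t : ℝ) : ℂ) ^
        Module.finrank ℂ (LinearMap.ker (Matrix.toLin' (A - 1))))) := by
  obtain ⟨F, hF, hF1, hdet⟩ := exists_det_one_sub_smul_eq_pow_mul A hk hA
  have hv : HasDerivAt (fun δ : ℝ => Real.exp (δ * t)) t 0 := by
    simpa using ((hasDerivAt_id (0 : ℝ)).mul_const t).exp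
  have hu : HasDerivAt (fun δ : ℝ => (1 + δ) * Real.exp (δ * t)) (1 + t) 0 := by
    have h := ((hasDerivAt_id (0 : ℝ)).const_add 1).mul hv
    simp only [id, zero_mul, Real.exp_zero, add_zero, one_mul] at h
    exact h
  have hFlim {w : ℝ → ℝ} {w' : ℝ} (hw : HasDerivAt w w' 0) (hw0 : w 0 = 1) :
      Filter.Tendsto (fun δ => F (w δ)) (𝓝[≠] 0) (𝓝 (F 1)) := by
    refine hF.tendsto.comp (Filter.Tendsto.mono_left ?_ nhdsWithin_le_nhds)
    have h := (Complex.continuous_ofReal.continuousAt.comp hw.continuousAt).tendsto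
    simpa [Function.comp_def, hw0] using h
  have hFv := hFlim hv (by simp)
  have hFu := hFlim hu (by simp)
  have hlim := ((Complex.continuous_ofReal.tendsto _).comp
    (tendsto_one_sub_div_one_sub hu hv (by simp) (by simp) ht)).pow
      (Module.finrank ℂ (LinearMap.ker (Matrix.toLin' (A - 1)))) |>.mul (hFu.div hFv hF1)
  rw [div_self hF1, mul_one] at hlim
  have hexp (δ : ℝ) : ((Real.exp (δ * t) : ℝ) : ℂ) ≠ 0 := by
    exact_mod_cast (Real.exp_pos _).ne'
  constructor
  · filter_upwards [self_mem_nhdsWithin, hFv.eventually_ne hF1] with δ hδ hne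
    rw [hdet _ (hexp δ)]
    refine mul_ne_zero (pow_ne_zero _ (sub_ne_zero.2 fun h => ?_)) hne
    have h : Real.exp (δ * t) = 1 := by exact_mod_cast h.symm
    exact mul_ne_zero hδ ht (Real.exp_eq_one_iff _ |>.1 h)
  · refine hlim.congr' ?_
    have hpos : ∀ᶠ δ : ℝ in 𝓝[≠] 0, (1 + δ) * Real.exp (δ * t) ≠ 0 :=
      (hu.continuousAt.eventually_ne (by simp)).filter_mono nhdsWithin_le_nhds
    filter_upwards [hpos] with δ hδ
    rw [hdet _ (hexp δ), hdet _ (by exact_mod_cast hδ), mul_div_mul_comm, ← div_pow]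
    simp

/-- **Chern–Schwartz–MacPherson limit formula.** Let `G ⊆ GL(n, ℂ)` be a finite
subgroup, `n ≥ 1`, and `t ≠ 0` a real number.  For `g ∈ G` let
`d_g = dim ker(g − 1)` be the dimension of the fixed subspace.  Then the function
`δ ↦ |G|⁻¹ ∑_{g} det(1 − (1+δ)e^{δt} g)/det(1 − e^{δt} g)` has nonzero denominators
for all sufficiently small real `δ ≠ 0`, and tends, as `δ → 0` through nonzero real
values, to `|G|⁻¹ ∑_{g} ((1+t)/t)^{d_g}`. -/
theorem csm_limit_formula
    (n : ℕ) (hn : 1 ≤ n) (t : ℝ) (ht : t ≠ 0)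
    (G : Subgroup (Matrix.GeneralLinearGroup (Fin n) ℂ)) [Fintype G]
    (d : G → ℕ)
    (hd : ∀ g : G, d g = Module.finrank ℂ (LinearMap.ker (Matrix.toLin'
      (((g : Matrix.GeneralLinearGroup (Fin n) ℂ) : Matrix (Fin n) (Fin n) ℂ) - 1)))) :
    (∀ᶠ δ : ℝ in 𝓝[≠] 0, ∀ g : G,
      Matrix.det ((1 : Matrix (Fin n) (Fin n) ℂ) - ((Real.exp (δ * t) : ℝ) : ℂ) •
        ((g : Matrix.GeneralLinearGroup (Fin n) ℂ) : Matrix (Fin n) (Fin n) ℂ)) ≠ 0) ∧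
    Filter.Tendsto
      (fun δ : ℝ => (Fintype.card G : ℂ)⁻¹ *
        ∑ g : G,
          Matrix.det ((1 : Matrix (Fin n) (Fin n) ℂ) -
              (((1 + δ) * Real.exp (δ * t) : ℝ) : ℂ) •
              ((g : Matrix.GeneralLinearGroup (Fin n) ℂ) : Matrix (Fin n) (Fin n) ℂ)) /
          Matrix.det ((1 : Matrix (Fin n) (Fin n) ℂ) - ((Real.exp (δ * t) : ℝ) : ℂ) •
              ((g : Matrix.GeneralLinearGroup (Fin n) ℂ) : Matrix (Fin n) (Fin n) ℂ)))
      (𝓝[≠] 0)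
      (𝓝 ((Fintype.card G : ℂ)⁻¹ * ∑ g : G, (((1 + t) / t : ℝ) : ℂ) ^ (d g))) := by
  have h (g : G) := tendsto_det_one_sub_smul_div
    ((g : Matrix.GeneralLinearGroup (Fin n) ℂ) : Matrix (Fin n) (Fin n) ℂ)
    (Fintype.card_pos (α := G)) (by
      have hg : (g : Matrix.GeneralLinearGroup (Fin n) ℂ) ^ Fintype.card G = 1 := by
        exact_mod_cast congrArg Subtype.val (pow_card_eq_one (x := g))
      simpa using congrArg Units.val hg) ht
  refine ⟨Filter.eventually_all.2 fun g => (h g).1, Filter.Tendsto.const_mul _ ?_⟩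
  refine tendsto_finsetSum _ fun g _ => ?_
  rw [hd g]
  exact (h g).2
end

section
/- Let n ≥ 1 and let ζ = exp(2πi/n) ∈ ℂ. Then in K₃ one has A_n = Σ_{i=0}^{n−1} [ (1 + y·T₁^{i+1}·T₂^{i+1}·T₂^{−n}) / (1 − T₁^{i+1}·T₂^{i+1}·T₂^{−n}) ] · [ (1 + y·T₁^{−i}·T₂^{n−i}) / (1 − T₁^{−i}·T₂^{n−i}) ] + (n−1)·y, i.e. the Hirzebruch class of the A_{n−1} singularity computed via its toric resolution equals the hypersurface expression A_n. -/
open scoped BigOperators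

/-- The fraction field `K₃` of the polynomial ring `ℂ[y, T₁, T₂]` in three variables. -/
noncomputable abbrev K3 : Type := FractionRing (MvPolynomial (Fin 3) ℂ)

/-- The variable `y ∈ K₃`. -/
noncomputable abbrev k3y : K3 := algebraMap (MvPolynomial (Fin 3) ℂ) K3 (MvPolynomial.X 0)

/-- The variable `T₁ ∈ K₃`. -/
noncomputable abbrev k3T1 : K3 := algebraMap (MvPolynomial (Fin 3) ℂ) K3 (MvPolynomial.X 1)

/-- The variable `T₂ ∈ K₃`. -/
noncomputable abbrev k3T2 : K3 := algebraMap (MvPolynomial (Fin 3) ℂ) K3 (MvPolynomial.X 2)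

/-- The hypersurface expression for the two-torus-equivariant Hirzebruch class of the
`A_{n−1}` singularity:
`A_n = (1+y)(1 + T₁T₂y)(1 − (T₁T₂)^n)/((1 − T₁T₂)(1 − T₁^n)(1 − T₂^n)) − y ∈ K₃`. -/
noncomputable def Ahyp (n : ℕ) : K3 :=
  (1 + k3y) * (1 + k3T1 * k3T2 * k3y) * (1 - (k3T1 * k3T2) ^ n) /
    ((1 - k3T1 * k3T2) * (1 - k3T1 ^ n) * (1 - k3T2 ^ n)) - k3y

/-- The product of the two local factors at a torus-fixed point whose tangent weights are
`c / d` and `a / b` splits as a difference, up to the constant `-y`. -/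
theorem localFactor_eq {K : Type*} [Field K] {y p a b c d : K} (hb : b ≠ 0) (hd : d ≠ 0)
    (hab : b - a ≠ 0) (hcd : d - c ≠ 0) (hp : 1 - p ≠ 0) (h : a * c = p * (b * d)) :
    (1 + y * (c / d)) / (1 - c / d) * ((1 + y * (a / b)) / (1 - a / b)) =
      -y + (1 + y) * (1 + y * p) / (1 - p) * (b / (b - a) - c / (c - d)) := by
  have e1 : 1 - c / d = (d - c) / d := by field_simp
  have e2 : 1 - a / b = (b - a) / b := by field_simp
  have e3 : c / (c - d) = -c / (d - c) := by rw [← neg_sub d c, div_neg, neg_div]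
  rw [e1, e2, e3]
  field_simp
  linear_combination (1 + y) ^ 2 * h

/-- The resolution formula over an arbitrary field, at a point where no denominator vanishes. -/
theorem resolution_sum_eq {K : Type*} [Field K] {y s t : K} {n : ℕ} (hs : s ≠ 0) (ht : t ≠ 0)
    (hst : 1 - s * t ≠ 0) (h : ∀ i ≤ n, s ^ i - t ^ (n - i) ≠ 0) :
    (1 + y) * (1 + s * t * y) * (1 - (s * t) ^ n) /
        ((1 - s * t) * (1 - s ^ n) * (1 - t ^ n)) - y =
      (∑ i ∈ Finset.range n,
        ((1 + y * (s ^ (i + 1) * t ^ (i + 1) * (t ^ n)⁻¹)) /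
          (1 - s ^ (i + 1) * t ^ (i + 1) * (t ^ n)⁻¹)) *
        ((1 + y * ((s ^ i)⁻¹ * t ^ (n - i))) / (1 - (s ^ i)⁻¹ * t ^ (n - i)))) +
      ((n : K) - 1) * y := by
  have term : ∀ i ∈ Finset.range n,
      ((1 + y * (s ^ (i + 1) * t ^ (i + 1) * (t ^ n)⁻¹)) /
          (1 - s ^ (i + 1) * t ^ (i + 1) * (t ^ n)⁻¹)) *
        ((1 + y * ((s ^ i)⁻¹ * t ^ (n - i))) / (1 - (s ^ i)⁻¹ * t ^ (n - i))) =
      -y + (1 + y) * (1 + y * (s * t)) / (1 - s * t) *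
        (s ^ i / (s ^ i - t ^ (n - i)) -
          s ^ (i + 1) / (s ^ (i + 1) - t ^ (n - (i + 1)))) := by
    intro i hi
    have hi : i + 1 ≤ n := Finset.mem_range.mp hi
    have e1 : s ^ (i + 1) * t ^ (i + 1) * (t ^ n)⁻¹ = s ^ (i + 1) / t ^ (n - (i + 1)) := by
      have e : t ^ n = t ^ (i + 1) * t ^ (n - (i + 1)) := by rw [← pow_add, Nat.add_sub_of_le hi]
      rw [e]
      field_simp
    have e2 : (s ^ i)⁻¹ * t ^ (n - i) = t ^ (n - i) / s ^ i := by
      rw [div_eq_mul_inv, mul_comm]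
    rw [e1, e2]
    refine localFactor_eq (pow_ne_zero _ hs) (pow_ne_zero _ ht) (h i (by omega)) ?_ hst ?_
    · rw [← neg_sub, neg_ne_zero]
      exact h _ hi
    · rw [show n - i = n - (i + 1) + 1 by omega]
      ring
  have h0 : 1 - t ^ n ≠ 0 := by simpa using h 0 n.zero_le
  have hn : s ^ n - 1 ≠ 0 := by simpa using h n le_rfl
  have hn' : 1 - s ^ n ≠ 0 := by rwa [← neg_sub, neg_ne_zero]
  rw [Finset.sum_congr rfl term, Finset.sum_add_distrib, ← Finset.mul_sum,
    Finset.sum_range_sub' fun i => s ^ i / (s ^ i - t ^ (n - i))]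
  simp only [Finset.sum_const, Finset.card_range, nsmul_eq_mul, pow_zero, Nat.sub_zero,
    Nat.sub_self]
  have e3 : s ^ n / (s ^ n - 1) = -s ^ n / (1 - s ^ n) := by
    rw [← neg_sub 1 (s ^ n), div_neg, neg_div]
  rw [e3, mul_pow]
  field_simp
  ring

theorem algebraMap_K3_ne_zero {f : MvPolynomial (Fin 3) ℂ} (v : Fin 3 → ℂ)
    (h : MvPolynomial.eval v f ≠ 0) : algebraMap (MvPolynomial (Fin 3) ℂ) K3 f ≠ 0 := by
  rw [Ne, FaithfulSMul.algebraMap_eq_zero_iff]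
  rintro rfl
  exact h (map_zero _)

/-- **Resolution formula for `A_{n−1}`.** For `n ≥ 1`, the Hirzebruch class of the
`A_{n−1}` singularity computed via its toric resolution,
`∑_{i=0}^{n−1} (1 + y·T₁^{i+1}T₂^{i+1−n})/(1 − T₁^{i+1}T₂^{i+1−n}) ·
(1 + y·T₁^{−i}T₂^{n−i})/(1 − T₁^{−i}T₂^{n−i}) + (n−1)y`,
equals the hypersurface expression `A_n`. -/
theorem Anminus1_resolution_formula
    (n : ℕ) (hn : 1 ≤ n) (ζ : ℂ) (hζ : ζ = Complex.exp (2 * Real.pi * Complex.I / n)) :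
    Ahyp n =
      (∑ i ∈ Finset.range n,
        ((1 + k3y * (k3T1 ^ (i + 1) * k3T2 ^ (i + 1) * (k3T2 ^ n)⁻¹)) /
          (1 - k3T1 ^ (i + 1) * k3T2 ^ (i + 1) * (k3T2 ^ n)⁻¹)) *
        ((1 + k3y * ((k3T1 ^ i)⁻¹ * k3T2 ^ (n - i))) /
          (1 - (k3T1 ^ i)⁻¹ * k3T2 ^ (n - i))))
      + ((n : K3) - 1) * k3y := by
  rw [Ahyp]
  refine resolution_sum_eq ?_ ?_ ?_ fun i hi => ?_
  · exact algebraMap_K3_ne_zero 1 (by simp)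
  · exact algebraMap_K3_ne_zero 1 (by simp)
  · simpa using algebraMap_K3_ne_zero (f := 1 - .X 1 * .X 2) 0 (by simp)
  · rw [← map_pow, ← map_pow, ← map_sub]
    refine algebraMap_K3_ne_zero ![0, 0, 2] ?_
    rcases i.eq_zero_or_pos with rfl | h
    · have : (2 : ℂ) ^ n ≠ 1 := by
        exact_mod_cast (Nat.one_lt_two_pow (by omega : n ≠ 0)).ne'
      simpa [sub_eq_zero] using this.symm
    · simp [h.ne']
end

section
/- (Du Val A_{n−1} identity.) Let n ≥ 1 and let ζ = exp(2πi/n) ∈ ℂ. Then in the field of fractions K of ℂ[y, T] one has n⁻¹ · Σ_{k=0}^{n−1} (1 + (ζ^k + ζ^{−k})·y·T + y²·T²) / (1 − (ζ^k + ζ^{−k})·T + T²) = (y+1)·(y·T² + 1)·(1 − T^{2n}) / ((1 − T²)·(1 − T^n)²) − y; note ζ^k + ζ^{−k} = 2·cos(2kπ/n), so this is the paper's identity between the Molien-series expression (1/n)Σ_k (1 + 2cos(2kπ/n)yT + y²T²)/(1 − 2cos(2kπ/n)T + T²) and the hypersurface formula for the Hirzebruch class of the A_{n−1} Du Val singularity.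 -/
open scoped BigOperators

/-- The sum of `(1 - ω^k x)⁻¹` over the powers of a primitive `n`-th root of unity `ω`. -/
theorem IsPrimitiveRoot.sum_inv_one_sub_pow_mul {F : Type*} [Field F] {n : ℕ} {ω : F}
    (hω : IsPrimitiveRoot ω n) (hn : 1 ≤ n) {x : F} (hx : x ^ n ≠ 1) :
    ∑ k ∈ Finset.range n, (1 - ω ^ k * x)⁻¹ = n / (1 - x ^ n) := by
  have hx' : 1 - x ^ n ≠ 0 := sub_ne_zero.2 hx.symm
  have hpow (k : ℕ) : (ω ^ k * x) ^ n = x ^ n := by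
    rw [mul_pow, ← pow_mul, mul_comm k, pow_mul, hω.pow_eq_one, one_pow, one_mul]
  have hgeom (k : ℕ) : (1 - ω ^ k * x)⁻¹ * (1 - x ^ n)
      = ∑ j ∈ Finset.range n, (ω ^ k * x) ^ j := by
    have h : 1 - ω ^ k * x ≠ 0 := fun h ↦ hx <| by
      rw [← hpow k, ← sub_eq_zero.1 h, one_pow]
    rw [inv_mul_eq_iff_eq_mul₀ h, mul_neg_geom_sum, hpow]
  have horth (j : ℕ) (hj : j ∈ Finset.range n) (hj0 : j ≠ 0) :
      ∑ k ∈ Finset.range n, (ω ^ k * x) ^ j = 0 := by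
    have hne : ω ^ j ≠ 1 := hω.pow_ne_one_of_pos_of_lt hj0 (Finset.mem_range.1 hj)
    have h : ∑ k ∈ Finset.range n, (ω ^ j) ^ k = 0 := by
      rw [geom_sum_eq hne, ← pow_mul, mul_comm, pow_mul, hω.pow_eq_one, one_pow, sub_self,
        zero_div]
    simp_rw [mul_pow, ← pow_mul, mul_comm _ j, pow_mul, ← Finset.sum_mul, h, zero_mul]
  rw [eq_div_iff hx', Finset.sum_mul, Finset.sum_congr rfl fun k _ ↦ hgeom k, Finset.sum_comm,
    Finset.sum_eq_single_of_mem 0 (Finset.mem_range.2 hn) horth]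
  simp

/-- The Molien-series identity for a cyclic group acting by `diag (ω, ω⁻¹)`, over any field. -/
theorem IsPrimitiveRoot.molien_sum_eq {F : Type*} [Field F] {n : ℕ} {ω : F}
    (hω : IsPrimitiveRoot ω n) (hn : 1 ≤ n) (hnF : (n : F) ≠ 0) {x : F} (hx : x ^ n ≠ 1)
    (hx2 : x ^ 2 ≠ 1) (y : F) :
    (n : F)⁻¹ * ∑ k ∈ Finset.range n,
        (1 + (ω ^ k + ω⁻¹ ^ k) * (y * x) + y ^ 2 * x ^ 2) /
          (1 - (ω ^ k + ω⁻¹ ^ k) * x + x ^ 2)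
      = (y + 1) * (y * x ^ 2 + 1) * (1 - x ^ (2 * n)) / ((1 - x ^ 2) * (1 - x ^ n) ^ 2) - y := by
  have hxn : 1 - x ^ n ≠ 0 := sub_ne_zero.2 hx.symm
  have hx2' : 1 - x ^ 2 ≠ 0 := sub_ne_zero.2 hx2.symm
  have hne {η : F} (hη : IsPrimitiveRoot η n) (k : ℕ) : 1 - η ^ k * x ≠ 0 := fun h ↦ hx <| by
    have h1 : (η ^ k * x) ^ n = 1 := by rw [← sub_eq_zero.1 h, one_pow]
    rwa [mul_pow, ← pow_mul, mul_comm k, pow_mul, hη.pow_eq_one, one_pow, one_mul] at h1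
  have hterm (k : ℕ) : (1 + (ω ^ k + ω⁻¹ ^ k) * (y * x) + y ^ 2 * x ^ 2) /
        (1 - (ω ^ k + ω⁻¹ ^ k) * x + x ^ 2)
      = (y + 1) * (y * x ^ 2 + 1) / (1 - x ^ 2) *
          ((1 - ω ^ k * x)⁻¹ + (1 - ω⁻¹ ^ k * x)⁻¹ - 1) - y := by
    have ha := hne hω k
    have hb := hne hω.inv k
    have hab : ω ^ k * ω⁻¹ ^ k = 1 := by
      rw [← mul_pow, mul_inv_cancel₀ (hω.ne_zero (by lia)), one_pow]
    generalize ω ^ k = a at *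
    generalize ω⁻¹ ^ k = b at *
    have hD : 1 - (a + b) * x + x ^ 2 = (1 - a * x) * (1 - b * x) := by
      linear_combination (-x ^ 2) * hab
    have hsum : (1 - a * x)⁻¹ + (1 - b * x)⁻¹ - 1
        = (1 - x ^ 2) / ((1 - a * x) * (1 - b * x)) := by
      rw [inv_add_inv ha hb, div_sub_one (mul_ne_zero ha hb)]
      congr 1
      linear_combination (-x ^ 2) * hab
    rw [hsum, hD, div_mul_div_cancel₀ hx2', div_sub' (mul_ne_zero ha hb)]
    congr 1
    linear_combination (x ^ 2 * y) * hab
  simp_rw [hterm, Finset.sum_sub_distrib, ← Finset.mul_sum, Finset.sum_sub_distrib,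
    Finset.sum_add_distrib, hω.sum_inv_one_sub_pow_mul hn hx,
    hω.inv.sum_inv_one_sub_pow_mul hn hx, Finset.sum_const, Finset.card_range, nsmul_eq_mul]
  field_simp
  ring

theorem molienT_pow_ne_one {m : ℕ} (hm : m ≠ 0) : molienT ^ m ≠ 1 := by
  rw [molienT, ← map_pow, ← map_one (algebraMap (MvPolynomial (Fin 2) ℂ) MolienK)]
  refine fun h ↦ zero_ne_one (α := ℂ) ?_
  simpa [hm] using
    congrArg (MvPolynomial.eval 0) (IsFractionRing.injective (MvPolynomial (Fin 2) ℂ) MolienK h)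

/-- **Du Val `A_{n−1}` identity.** For `n ≥ 1` and `ζ = exp(2πi/n)`, in `K = ℂ(y, T)`
the Molien-series expression
`n⁻¹ ∑_{k=0}^{n−1} (1 + (ζ^k + ζ^{−k})yT + y²T²)/(1 − (ζ^k + ζ^{−k})T + T²)`
(note `ζ^k + ζ^{−k} = 2cos(2kπ/n)`) equals the hypersurface formula
`(y+1)(yT² + 1)(1 − T^{2n})/((1 − T²)(1 − T^n)²) − y` for the Hirzebruch class of
the `A_{n−1}` Du Val singularity. -/
theorem duval_A_hirzebruch
    (n : ℕ) (hn : 1 ≤ n) (ζ : ℂ) (hζ : ζ = Complex.exp (2 * Real.pi * Complex.I / n)) :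
    (n : MolienK)⁻¹ * ∑ k ∈ Finset.range n,
        (1 + algebraMap ℂ MolienK (ζ ^ k + ζ⁻¹ ^ k) * (molienY * molienT)
            + molienY ^ 2 * molienT ^ 2) /
          (1 - algebraMap ℂ MolienK (ζ ^ k + ζ⁻¹ ^ k) * molienT + molienT ^ 2)
      = (molienY + 1) * (molienY * molienT ^ 2 + 1) * (1 - molienT ^ (2 * n)) /
          ((1 - molienT ^ 2) * (1 - molienT ^ n) ^ 2)
        - molienY := by
  have hζ' : IsPrimitiveRoot ζ n := hζ ▸ Complex.isPrimitiveRoot_exp n (by lia)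
  have hinj : Function.Injective (algebraMap ℂ MolienK) := (algebraMap ℂ MolienK).injective
  have hnK : (n : MolienK) ≠ 0 := by
    rw [← map_natCast (algebraMap ℂ MolienK), (map_ne_zero_iff _ hinj), Nat.cast_ne_zero]
    lia
  simpa only [map_add, map_pow, map_inv₀] using (hζ'.map_of_injective hinj).molien_sum_eq hn hnK
    (molienT_pow_ne_one (by lia)) (molienT_pow_ne_one two_ne_zero) molienY
end

section
/- (Lefschetz–Riemann–Roch identity for A_{n−1}.) Let n ≥ 1 and let ζ = exp(2πi/n) ∈ ℂ. Then in K₃ one has A_n = n⁻¹ · Σ_{k=0}^{n−1} [ (1 + y·ζ^k·T₁) / (1 − ζ^k·T₁) ] · [ (1 + y·ζ^{−k}·T₂) / (1 − ζ^{−k}·T₂) ], i.e. the Lefschetz–Riemann–Roch (Molien-type) expression for the two-torus-equivariant Hirzebruch class of the A_{n−1} singularity equals the hypersurface expression A_n. -/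
open scoped BigOperators

namespace IsPrimitiveRoot

variable {F : Type*} [Field F] {w : F} {n : ℕ}

lemma one_sub_pow_mul_ne_zero (hw : IsPrimitiveRoot w n) {a : F} (ha : 1 - a ^ n ≠ 0) (k : ℕ) :
    1 - w ^ k * a ≠ 0 := by
  intro h
  apply ha
  have h1 : w ^ k * a = 1 := (sub_eq_zero.mp h).symm
  have h2 : (w ^ k * a) ^ n = a ^ n := by
    rw [mul_pow, ← pow_mul, mul_comm k n, pow_mul, hw.pow_eq_one, one_pow, one_mul]
  rw [← h2, h1, one_pow, sub_self]

lemma sum_pow_pow_eq_zero (hw : IsPrimitiveRoot w n) {j : ℕ} (hj : j ≠ 0) (hjn : j < n) :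
    ∑ k ∈ Finset.range n, (w ^ k) ^ j = 0 := by
  have h1 : w ^ j - 1 ≠ 0 := sub_ne_zero.mpr (hw.pow_ne_one_of_pos_of_lt hj hjn)
  have h2 : ∑ k ∈ Finset.range n, (w ^ k) ^ j = ∑ k ∈ Finset.range n, (w ^ j) ^ k :=
    Finset.sum_congr rfl fun k _ => pow_right_comm w k j
  have h3 := geom_sum_mul (w ^ j) n
  rw [pow_right_comm, hw.pow_eq_one, one_pow, sub_self] at h3
  rw [h2]
  exact (mul_eq_zero.mp h3).resolve_right h1

/-- Partial fraction expansion of `n / (1 - a ^ n)`. -/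
lemma sum_inv_one_sub_pow_mul_s17 (hw : IsPrimitiveRoot w n) {a : F} (ha : 1 - a ^ n ≠ 0) :
    ∑ k ∈ Finset.range n, (1 - w ^ k * a)⁻¹ = n * (1 - a ^ n)⁻¹ := by
  have hn : 0 < n := Nat.pos_of_ne_zero fun h => ha (by simp [h])
  have key : ∀ k, (1 - w ^ k * a)⁻¹ =
      (∑ j ∈ Finset.range n, (w ^ k) ^ j * a ^ j) * (1 - a ^ n)⁻¹ := by
    intro k
    rw [eq_mul_inv_iff_mul_eq₀ ha, inv_mul_eq_iff_eq_mul₀ (hw.one_sub_pow_mul_ne_zero ha k)]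
    have h := mul_neg_geom_sum (w ^ k * a) n
    rw [mul_pow, ← pow_mul, mul_comm k n, pow_mul, hw.pow_eq_one, one_pow, one_mul] at h
    simp only [← mul_pow, h]
  simp only [key]
  rw [← Finset.sum_mul, Finset.sum_comm]
  congr 1
  simp only [← Finset.sum_mul]
  rw [Finset.sum_eq_single_of_mem 0 (Finset.mem_range.mpr hn)]
  · simp
  · intro j hj h0
    rw [hw.sum_pow_pow_eq_zero h0 (Finset.mem_range.mp hj), zero_mul]

/-- The Molien-type sum of the cyclic group acting by `diag(w, w⁻¹)`. -/
lemma inv_mul_sum_molien (hw : IsPrimitiveRoot w n) (hn : (n : F) ≠ 0) (y : F) {a b : F}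
    (ha : 1 - a ^ n ≠ 0) (hb : 1 - b ^ n ≠ 0) (hab : 1 - a * b ≠ 0) :
    (n : F)⁻¹ * ∑ k ∈ Finset.range n,
        ((1 + y * (w ^ k * a)) / (1 - w ^ k * a)) *
        ((1 + y * (w⁻¹ ^ k * b)) / (1 - w⁻¹ ^ k * b)) =
      (1 + y) * (1 + a * b * y) * (1 - (a * b) ^ n) /
        ((1 - a * b) * (1 - a ^ n) * (1 - b ^ n)) - y := by
  have hn0 : n ≠ 0 := fun h => hn (by simp [h])
  have term : ∀ k,
      ((1 + y * (w ^ k * a)) / (1 - w ^ k * a)) *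
        ((1 + y * (w⁻¹ ^ k * b)) / (1 - w⁻¹ ^ k * b)) =
      (1 + y) * (1 + a * b * y) / (1 - a * b) *
        ((1 - w ^ k * a)⁻¹ + (1 - w⁻¹ ^ k * b)⁻¹ - 1) - y := by
    intro k
    have hu := hw.one_sub_pow_mul_ne_zero ha k
    have hv := hw.inv.one_sub_pow_mul_ne_zero hb k
    have hz : w ^ k * w⁻¹ ^ k = 1 := by
      rw [← mul_pow, mul_inv_cancel₀ (hw.ne_zero hn0), one_pow]
    have huv : a * b = (w ^ k * a) * (w⁻¹ ^ k * b) := by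
      linear_combination (-(a * b)) * hz
    rw [huv] at hab ⊢
    generalize w ^ k * a = u at *
    generalize w⁻¹ ^ k * b = v at *
    field_simp
    ring
  simp only [term]
  rw [Finset.sum_sub_distrib, ← Finset.mul_sum, Finset.sum_sub_distrib, Finset.sum_add_distrib,
    hw.sum_inv_one_sub_pow_mul_s17 ha, hw.inv.sum_inv_one_sub_pow_mul_s17 hb]
  simp only [Finset.sum_const, Finset.card_range, nsmul_eq_mul, mul_one]
  rw [mul_pow]
  field_simp
  ring

end IsPrimitiveRoot

lemma one_sub_algebraMap_ne_zero {p : MvPolynomial (Fin 3) ℂ}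
    (hp : MvPolynomial.eval 0 p = 0) : 1 - algebraMap (MvPolynomial (Fin 3) ℂ) K3 p ≠ 0 := by
  rw [← map_one (algebraMap (MvPolynomial (Fin 3) ℂ) K3), ← map_sub]
  refine (map_ne_zero_iff _ (IsFractionRing.injective _ K3)).mpr fun h => ?_
  have h1 := congrArg (MvPolynomial.eval 0) h
  rw [map_sub, hp, map_one, map_zero, sub_zero] at h1
  exact one_ne_zero h1

/-- **Lefschetz–Riemann–Roch identity for `A_{n−1}`.** For `n ≥ 1` and
`ζ = exp(2πi/n)`, the Lefschetz–Riemann–Roch (Molien-type) expression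
`n⁻¹ ∑_{k=0}^{n−1} (1 + y·ζ^k·T₁)/(1 − ζ^k·T₁) · (1 + y·ζ^{−k}·T₂)/(1 − ζ^{−k}·T₂)`
equals the hypersurface expression `A_n` in `K₃`. -/
theorem Anminus1_LRR_formula
    (n : ℕ) (hn : 1 ≤ n) (ζ : ℂ) (hζ : ζ = Complex.exp (2 * Real.pi * Complex.I / n)) :
    Ahyp n =
      (n : K3)⁻¹ * ∑ k ∈ Finset.range n,
        ((1 + k3y * (algebraMap ℂ K3 (ζ ^ k) * k3T1)) /
          (1 - algebraMap ℂ K3 (ζ ^ k) * k3T1)) *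
        ((1 + k3y * (algebraMap ℂ K3 (ζ⁻¹ ^ k) * k3T2)) /
          (1 - algebraMap ℂ K3 (ζ⁻¹ ^ k) * k3T2)) := by
  have hn0 : n ≠ 0 := Nat.one_le_iff_ne_zero.mp hn
  have hw : IsPrimitiveRoot (algebraMap ℂ K3 ζ) n :=
    (hζ ▸ Complex.isPrimitiveRoot_exp n hn0).map_of_injective (algebraMap ℂ K3).injective
  have : CharZero K3 := charZero_of_injective_algebraMap (algebraMap ℂ K3).injective
  have ha : 1 - k3T1 ^ n ≠ 0 := by
    rw [← map_pow]
    exact one_sub_algebraMap_ne_zero (by simp [hn0])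
  have hb : 1 - k3T2 ^ n ≠ 0 := by
    rw [← map_pow]
    exact one_sub_algebraMap_ne_zero (by simp [hn0])
  have hab : 1 - k3T1 * k3T2 ≠ 0 := by
    rw [← map_mul]
    exact one_sub_algebraMap_ne_zero (by simp)
  simp only [map_pow, map_inv₀]
  exact (hw.inv_mul_sum_molien (Nat.cast_ne_zero.mpr hn0) k3y ha hb hab).symm
end

section
/- Let n ≥ 1 and let ζ = exp(2πi/n) ∈ ℂ. Then in the field of fractions K of ℂ[y, T] one has n⁻¹ · Σ_{k=0}^{n−1} (1 + y·T·ζ^k)² / (1 − T·ζ^k)² = (1 + (n−1)·T^n + 2n·T^n·y + ((n−1)·T^n + T^{2n})·y²) / (1 − T^n)², i.e. the Molien-series expression for the cyclic group ℤ_n acting diagonally on ℂ² by scalar multiplication by n-th roots of unity equals the closed formula of the paper (an example where SL-duality fails). -/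
open scoped BigOperators

section CyclicSums

variable {F : Type*} [Field F]

theorem one_sub_mul_sum_succ_mul_pow (a : F) (m : ℕ) :
    (1 - a) * ∑ j ∈ Finset.range m, ((j : F) + 1) * a ^ j
      = ∑ j ∈ Finset.range m, a ^ j - m * a ^ m := by
  induction m with
  | zero => simp
  | succ m ih =>
    rw [Finset.sum_range_succ, Finset.sum_range_succ, mul_add, ih]
    push_cast
    ring

theorem IsPrimitiveRoot.sum_sum_mul_pow {n : ℕ} {w : F} (hw : IsPrimitiveRoot w n)
    (hn : 1 ≤ n) (T : F) (c : ℕ → F) :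
    ∑ k ∈ Finset.range n, ∑ j ∈ Finset.range n, c j * (T * w ^ k) ^ j = n * c 0 := by
  rw [Finset.sum_comm, Finset.sum_eq_single_of_mem 0 (Finset.mem_range.2 hn)]
  · simp
  · intro j hj hj0
    have hwj : w ^ j ≠ 1 := hw.pow_ne_one_of_pos_of_lt hj0 (Finset.mem_range.1 hj)
    have hsum : ∑ k ∈ Finset.range n, (w ^ j) ^ k = 0 := by
      rw [geom_sum_eq hwj, ← pow_mul, mul_comm, pow_mul, hw.pow_eq_one]
      simp
    calc ∑ k ∈ Finset.range n, c j * (T * w ^ k) ^ j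
        = c j * T ^ j * ∑ k ∈ Finset.range n, (w ^ j) ^ k := by
          rw [Finset.mul_sum]
          exact Finset.sum_congr rfl fun k _ => by ring
      _ = 0 := by rw [hsum, mul_zero]

theorem IsPrimitiveRoot.mul_pow_pow {n : ℕ} {w : F} (hw : IsPrimitiveRoot w n) (T : F) (k : ℕ) :
    (T * w ^ k) ^ n = T ^ n := by
  rw [mul_pow, ← pow_mul, mul_comm k, pow_mul, hw.pow_eq_one, one_pow, mul_one]

theorem IsPrimitiveRoot.one_sub_mul_pow_ne_zero {n : ℕ} {w T : F} (hw : IsPrimitiveRoot w n)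
    (hT : 1 - T ^ n ≠ 0) (k : ℕ) : 1 - T * w ^ k ≠ 0 := by
  intro h
  apply hT
  rw [← hw.mul_pow_pow T k, ← sub_eq_zero.1 h, one_pow, sub_self]

theorem IsPrimitiveRoot.sum_inv_one_sub {n : ℕ} {w T : F} (hw : IsPrimitiveRoot w n)
    (hn : 1 ≤ n) (hT : 1 - T ^ n ≠ 0) :
    ∑ k ∈ Finset.range n, (1 - T * w ^ k)⁻¹ = n / (1 - T ^ n) := by
  rw [eq_div_iff hT, Finset.sum_mul]
  have h := hw.sum_sum_mul_pow hn T fun _ => 1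
  simp only [one_mul, mul_one] at h
  rw [← h]
  refine Finset.sum_congr rfl fun k _ => ?_
  rw [inv_mul_eq_iff_eq_mul₀ (hw.one_sub_mul_pow_ne_zero hT k), mul_neg_geom_sum, hw.mul_pow_pow]

theorem IsPrimitiveRoot.sum_inv_one_sub_sq {n : ℕ} {w T : F} (hw : IsPrimitiveRoot w n)
    (hn : 1 ≤ n) (hT : 1 - T ^ n ≠ 0) :
    ∑ k ∈ Finset.range n, ((1 - T * w ^ k)⁻¹) ^ 2
      = n * (1 + (n - 1) * T ^ n) / (1 - T ^ n) ^ 2 := by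
  have key : (∑ k ∈ Finset.range n, ((1 - T * w ^ k)⁻¹) ^ 2) * (1 - T ^ n)
      = n + n * T ^ n * (n / (1 - T ^ n)) := by
    have h := hw.sum_sum_mul_pow hn T fun j => (j : F) + 1
    simp only [Nat.cast_zero, zero_add, mul_one] at h
    rw [← hw.sum_inv_one_sub hn hT]
    nth_rewrite 1 [← h]
    rw [Finset.mul_sum, ← Finset.sum_add_distrib, Finset.sum_mul]
    refine Finset.sum_congr rfl fun k _ => ?_
    have ha := hw.one_sub_mul_pow_ne_zero hT k
    have h1 := one_sub_mul_sum_succ_mul_pow (T * w ^ k) n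
    have h2 := mul_neg_geom_sum (T * w ^ k) n
    rw [hw.mul_pow_pow] at h1 h2
    generalize T * w ^ k = a at *
    field_simp
    linear_combination -h2 - (1 - a) * h1
  rw [← eq_div_iff hT] at key
  rw [key]
  field_simp
  ring

theorem IsPrimitiveRoot.molien_sum {n : ℕ} {w T : F} (hw : IsPrimitiveRoot w n)
    (hn : 1 ≤ n) (hn0 : (n : F) ≠ 0) (hT : 1 - T ^ n ≠ 0) (y : F) :
    (n : F)⁻¹ * ∑ k ∈ Finset.range n, (1 + y * T * w ^ k) ^ 2 / (1 - T * w ^ k) ^ 2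
      = (1 + ((n : F) - 1) * T ^ n + 2 * (n : F) * T ^ n * y
          + (((n : F) - 1) * T ^ n + T ^ (2 * n)) * y ^ 2) / (1 - T ^ n) ^ 2 := by
  have hterm : ∀ k ∈ Finset.range n, (1 + y * T * w ^ k) ^ 2 / (1 - T * w ^ k) ^ 2
      = (1 + y) ^ 2 * ((1 - T * w ^ k)⁻¹) ^ 2 - 2 * y * (1 + y) * (1 - T * w ^ k)⁻¹ + y ^ 2 := by
    intro k _
    have ha := hw.one_sub_mul_pow_ne_zero hT k
    rw [mul_assoc y]
    generalize T * w ^ k = a at *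
    field_simp
    ring
  rw [Finset.sum_congr rfl hterm, Finset.sum_add_distrib, Finset.sum_sub_distrib,
    ← Finset.mul_sum, ← Finset.mul_sum, hw.sum_inv_one_sub hn hT, hw.sum_inv_one_sub_sq hn hT,
    Finset.sum_const, Finset.card_range, nsmul_eq_mul, mul_comm 2 n, pow_mul]
  generalize T ^ n = u at *
  field_simp
  ring

end CyclicSums

theorem one_sub_molienT_pow_ne_zero {n : ℕ} (hn : 1 ≤ n) : 1 - molienT ^ n ≠ 0 := by
  intro h
  have h1 : (MvPolynomial.X 1 : MvPolynomial (Fin 2) ℂ) ^ n = 1 := by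
    apply IsFractionRing.injective (MvPolynomial (Fin 2) ℂ) MolienK
    rw [map_pow, map_one]
    exact (sub_eq_zero.1 h).symm
  have h2 := congrArg (MvPolynomial.eval fun _ => (0 : ℂ)) h1
  simp [Nat.one_le_iff_ne_zero.1 hn] at h2

/-- **Diagonal cyclic quotient of `ℂ²`.** For `n ≥ 1` and `ζ = exp(2πi/n)`, in
`K = ℂ(y, T)` the Molien-series expression
`n⁻¹ ∑_{k=0}^{n−1} (1 + yTζ^k)²/(1 − Tζ^k)²` for `ℤ_n ⊂ GL(2, ℂ)` acting by scalar
multiplication equals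
`(1 + (n−1)T^n + 2nT^ny + ((n−1)T^n + T^{2n})y²)/(1 − T^n)²`
(an example where `SL`-duality fails). -/
theorem diagonal_cyclic_molien
    (n : ℕ) (hn : 1 ≤ n) (ζ : ℂ) (hζ : ζ = Complex.exp (2 * Real.pi * Complex.I / n)) :
    (n : MolienK)⁻¹ * ∑ k ∈ Finset.range n,
        (1 + molienY * molienT * algebraMap ℂ MolienK (ζ ^ k)) ^ 2 /
          (1 - molienT * algebraMap ℂ MolienK (ζ ^ k)) ^ 2
      = (1 + ((n : MolienK) - 1) * molienT ^ n + 2 * (n : MolienK) * molienT ^ n * molienY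
          + (((n : MolienK) - 1) * molienT ^ n + molienT ^ (2 * n)) * molienY ^ 2) /
        (1 - molienT ^ n) ^ 2 := by
  have hn0 : n ≠ 0 := Nat.one_le_iff_ne_zero.1 hn
  have hw : IsPrimitiveRoot (algebraMap ℂ MolienK ζ) n :=
    (hζ ▸ Complex.isPrimitiveRoot_exp n hn0).map_of_injective (algebraMap ℂ MolienK).injective
  have hnK : (n : MolienK) ≠ 0 := by
    rw [← map_natCast (algebraMap ℂ MolienK), map_ne_zero]
    exact_mod_cast hn0
  simp only [map_pow]
  exact hw.molien_sum hn hnK (one_sub_molienT_pow_ne_zero hn) molienY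
end
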